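/- arXiv:1208.2714 — 3 statements merged into one kernel-verified Lean document; each statement's English description precedes it below -/
import Mathlib

section
/- Let R be a field and H a finite-dimensional associative Z-graded R-algebra. If the set Irr(H) of irreducible characters of H (characters of the simple ungraded H-modules) is a linearly independent subset of Hom_R(H,R), then the set Irr^gr(H) = { χ^gr_{M⟨j⟩} : M a simple graded H-module, j ∈ Z } of irreducible graded characters is a linearly independent subset of Hom_R(H, R[t,t^{-1}]). -/
universe u

open DirectSum Function

/-! ## Modules over `S ⊗_A H`

For an `A`-algebra `H` and a commutative `A`-algebra `S`, a (finitely generated) module over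
the `S`-algebra `S ⊗_A H` is the same thing as an `S`-module together with a commuting
`H`-action such that the two induced `A`-actions agree.  We package this data in a structure. -/

structure ModPkg (A : Type u) [CommRing A] (H : Type u) [Ring H] [Algebra A H]
    (S : Type u) [CommRing S] [Algebra A S] : Type (u + 1) where
  carrier : Type u
  [acg : AddCommGroup carrier]
  [modS : Module S carrier]
  [modH : Module H carrier]
  smul_comm' : ∀ (h : H) (s : S) (x : carrier), h • s • x = s • h • x
  compat : ∀ (a : A) (x : carrier), (algebraMap A H a) • x = (algebraMap A S a) • x
  [fin : Module.Finite S carrier]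

attribute [instance] ModPkg.acg ModPkg.modS ModPkg.modH ModPkg.fin

section Ungraded

variable {A : Type u} [CommRing A] {H : Type u} [Ring H] [Algebra A H]
  {S : Type u} [CommRing S] [Algebra A S]

namespace ModPkg

/-- A subgroup stable under both scalar actions, i.e. an `S ⊗_A H`-submodule. -/
def IsStable (M : ModPkg A H S) (p : AddSubgroup M.carrier) : Prop :=
  (∀ (s : S), ∀ x ∈ p, s • x ∈ p) ∧ (∀ (h : H), ∀ x ∈ p, h • x ∈ p)

/-- Simplicity of an `S ⊗_A H`-module. -/
def Simple (M : ModPkg A H S) : Prop :=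
  Nontrivial M.carrier ∧ ∀ p : AddSubgroup M.carrier, M.IsStable p → p = ⊥ ∨ p = ⊤

/-- Isomorphism of `S ⊗_A H`-modules. -/
def Iso (M N : ModPkg A H S) : Prop :=
  ∃ e : M.carrier ≃+ N.carrier,
    (∀ (s : S) (x : M.carrier), e (s • x) = s • e x) ∧
    (∀ (h : H) (x : M.carrier), e (h • x) = h • e x)

/-- The action of an element of `H` as an `S`-linear endomorphism. -/
noncomputable def act (M : ModPkg A H S) (h : H) : M.carrier →ₗ[S] M.carrier where
  toFun x := h • x
  map_add' x y := smul_add h x y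
  map_smul' s x := by simpa using M.smul_comm' h s x

/-- The character of an `S ⊗_A H`-module, as a function on `H`. -/
noncomputable def char (M : ModPkg A H S) : H → S :=
  fun h => LinearMap.trace S M.carrier (M.act h)

/-- The factor `q/p` is isomorphic to `M` (as `S ⊗_A H`-modules), witnessed by a surjection
`q → M` with kernel `p`. -/
def IsFactor (V : ModPkg A H S) (p q : AddSubgroup V.carrier) (M : ModPkg A H S) : Prop :=
  ∃ φ : q →+ M.carrier,
    Surjective φ ∧
    (∀ x : q, φ x = 0 ↔ (x : V.carrier) ∈ p) ∧
    (∀ (s : S) (x y : q), (y : V.carrier) = s • (x : V.carrier) → φ y = s • φ x) ∧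
    (∀ (h : H) (x y : q), (y : V.carrier) = h • (x : V.carrier) → φ y = h • φ x)

end ModPkg

/-- An (ungraded) composition series of an `S ⊗_A H`-module. -/
structure CompSeries (V : ModPkg A H S) : Type u where
  len : ℕ
  c : Fin (len + 1) → AddSubgroup V.carrier
  mono : ∀ t : Fin len, c t.castSucc ≤ c t.succ
  bot : c 0 = ⊥
  top : c (Fin.last len) = ⊤
  stable : ∀ t, V.IsStable (c t)
  steps : ∀ t : Fin len, c t.castSucc ≠ c t.succ ∧
    ∀ p : AddSubgroup V.carrier, V.IsStable p → c t.castSucc ≤ p → p ≤ c t.succ →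
      p = c t.castSucc ∨ p = c t.succ

/-- The multiplicity of the simple module `M` in a composition series. -/
noncomputable def ModPkg.mult (V : ModPkg A H S) (cs : CompSeries V) (M : ModPkg A H S) : ℕ :=
  Nat.card { t : Fin cs.len // V.IsFactor (cs.c t.castSucc) (cs.c t.succ) M }

end Ungraded

/-- The algebra `S ⊗_A H` is split: the endomorphism algebra of every simple module is `S`. -/
def SplitAlg (A : Type u) [CommRing A] (H : Type u) [Ring H] [Algebra A H]
    (S : Type u) [CommRing S] [Algebra A S] : Prop :=
  ∀ M : ModPkg A H S, M.Simple →
    ∀ f : M.carrier →+ M.carrier,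
      (∀ (s : S) (x : M.carrier), f (s • x) = s • f x) →
      (∀ (h : H) (x : M.carrier), f (h • x) = h • f x) →
      ∃ s : S, ∀ x, f x = s • x

/-- The set of irreducible characters of `S ⊗_A H`. -/
def IrrChars (A : Type u) [CommRing A] (H : Type u) [Ring H] [Algebra A H]
    (S : Type u) [CommRing S] [Algebra A S] : Set (H → S) :=
  { χ | ∃ M : ModPkg A H S, M.Simple ∧ χ = M.char }

/-! ## Graded modules over `S ⊗_A H` for a `ℤ`-graded algebra `H = ⊕ 𝒜 i` -/

structure GrMod (A : Type u) [CommRing A] (H : Type u) [Ring H] [Algebra A H]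
    (𝒜 : ℤ → Submodule A H) (S : Type u) [CommRing S] [Algebra A S] : Type (u + 1) where
  carrier : Type u
  [acg : AddCommGroup carrier]
  [modS : Module S carrier]
  [modH : Module H carrier]
  smul_comm' : ∀ (h : H) (s : S) (x : carrier), h • s • x = s • h • x
  compat : ∀ (a : A) (x : carrier), (algebraMap A H a) • x = (algebraMap A S a) • x
  [fin : Module.Finite S carrier]
  grading : ℤ → Submodule S carrier
  [decomp : DirectSum.Decomposition grading]
  grading_smul : ∀ (i j : ℤ) (h : H), h ∈ 𝒜 i → ∀ x ∈ grading j, h • x ∈ grading (i + j)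

attribute [instance] GrMod.acg GrMod.modS GrMod.modH GrMod.fin GrMod.decomp

section Graded

variable {A : Type u} [CommRing A] {H : Type u} [Ring H] [Algebra A H]
  {𝒜 : ℤ → Submodule A H} {S : Type u} [CommRing S] [Algebra A S]

namespace GrMod

/-- The underlying ungraded module of a graded module. -/
def forget (V : GrMod A H 𝒜 S) : ModPkg A H S where
  carrier := V.carrier
  acg := V.acg
  modS := V.modS
  modH := V.modH
  smul_comm' := V.smul_comm'
  compat := V.compat
  fin := V.fin

/-- The action of a degree-`0` element of `H` on the degree-`i` piece of a graded module,
as an `S`-linear endomorphism; this is the representation `ρ_{V_i}` restricted to `H_0`. -/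
noncomputable def degAct (V : GrMod A H 𝒜 S) (h : 𝒜 0) (i : ℤ) :
    V.grading i →ₗ[S] V.grading i where
  toFun x := ⟨(h : H) • (x : V.carrier), by
    simpa using V.grading_smul 0 i (h : H) h.2 (x : V.carrier) x.2⟩
  map_add' x y := by
    apply Subtype.ext
    simp [smul_add]
  map_smul' s x := by
    apply Subtype.ext
    simpa using V.smul_comm' (h : H) s (x : V.carrier)

/-- A subgroup which is an `S ⊗_A H`-submodule and is graded. -/
def IsGrSub (V : GrMod A H 𝒜 S) (p : AddSubgroup V.carrier) : Prop :=
  V.forget.IsStable p ∧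
    ∀ x ∈ p, ∀ i : ℤ, ((DirectSum.decompose V.grading x i : V.grading i) : V.carrier) ∈ p

/-- A graded module is graded-simple if it is nonzero and has no nontrivial graded submodule. -/
def GrSimple (V : GrMod A H 𝒜 S) : Prop :=
  Nontrivial V.carrier ∧ ∀ p : AddSubgroup V.carrier, V.IsGrSub p → p = ⊥ ∨ p = ⊤

/-- Isomorphism of graded modules. -/
def GrIso (V W : GrMod A H 𝒜 S) : Prop :=
  ∃ e : V.carrier ≃+ W.carrier,
    (∀ (s : S) (x : V.carrier), e (s • x) = s • e x) ∧
    (∀ (h : H) (x : V.carrier), e (h • x) = h • e x) ∧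
    (∀ (i : ℤ), ∀ x ∈ V.grading i, e x ∈ W.grading i)

/-- `W` is the shift `V⟨j⟩` of `V`, i.e. `W_i = V_{i-j}`. -/
def IsShiftOf (W V : GrMod A H 𝒜 S) (j : ℤ) : Prop :=
  ∃ e : W.carrier ≃+ V.carrier,
    (∀ (s : S) (x : W.carrier), e (s • x) = s • e x) ∧
    (∀ (h : H) (x : W.carrier), e (h • x) = h • e x) ∧
    (∀ (i : ℤ), ∀ x ∈ W.grading i, e x ∈ V.grading (i - j))

/-- The factor `q/p` of a graded module is isomorphic, as a graded module, to the shift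
`M⟨n⟩` of `M`. -/
def IsFactorShift (V : GrMod A H 𝒜 S) (p q : AddSubgroup V.carrier)
    (M : GrMod A H 𝒜 S) (n : ℤ) : Prop :=
  ∃ φ : q →+ M.carrier,
    Surjective φ ∧
    (∀ x : q, φ x = 0 ↔ (x : V.carrier) ∈ p) ∧
    (∀ (s : S) (x y : q), (y : V.carrier) = s • (x : V.carrier) → φ y = s • φ x) ∧
    (∀ (h : H) (x y : q), (y : V.carrier) = h • (x : V.carrier) → φ y = h • φ x) ∧
    (∀ (i : ℤ) (x : q), (x : V.carrier) ∈ V.grading i → φ x ∈ M.grading (i - n)) ∧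
    (∀ (i : ℤ), ∀ m ∈ M.grading (i - n), ∃ x : q, (x : V.carrier) ∈ V.grading i ∧ φ x = m)

end GrMod

/-- A graded composition series of a graded module. -/
structure GrCompSeries (V : GrMod A H 𝒜 S) : Type u where
  len : ℕ
  c : Fin (len + 1) → AddSubgroup V.carrier
  mono : ∀ t : Fin len, c t.castSucc ≤ c t.succ
  bot : c 0 = ⊥
  top : c (Fin.last len) = ⊤
  graded : ∀ t, V.IsGrSub (c t)
  steps : ∀ t : Fin len, c t.castSucc ≠ c t.succ ∧
    ∀ p : AddSubgroup V.carrier, V.IsGrSub p → c t.castSucc ≤ p → p ≤ c t.succ →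
      p = c t.castSucc ∨ p = c t.succ

/-- The multiplicity `[V : M⟨n⟩]^gr` of the shifted graded simple module `M⟨n⟩` in a graded
composition series of `V`. -/
noncomputable def GrMod.multShift (V : GrMod A H 𝒜 S) (cs : GrCompSeries V)
    (M : GrMod A H 𝒜 S) (n : ℤ) : ℕ :=
  Nat.card { t : Fin cs.len // V.IsFactorShift (cs.c t.castSucc) (cs.c t.succ) M n }

/-- The graded decomposition number `∑_n q^n [V : M⟨n⟩]^gr ∈ ℕ[q,q⁻¹]`. -/
noncomputable def GrMod.entryPoly (V : GrMod A H 𝒜 S) (cs : GrCompSeries V)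
    (M : GrMod A H 𝒜 S) : LaurentPolynomial ℕ :=
  ∑ᶠ n : ℤ, (V.multShift cs M n) • LaurentPolynomial.T n

/-- A short exact sequence of graded modules (morphisms are of degree `0`). -/
structure GrSES (X Y Z : GrMod A H 𝒜 S) : Type u where
  f : X.carrier →+ Y.carrier
  g : Y.carrier →+ Z.carrier
  f_smulS : ∀ (s : S) (x : X.carrier), f (s • x) = s • f x
  f_smulH : ∀ (h : H) (x : X.carrier), f (h • x) = h • f x
  g_smulS : ∀ (s : S) (y : Y.carrier), g (s • y) = s • g y
  g_smulH : ∀ (h : H) (y : Y.carrier), g (h • y) = h • g y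
  inj : Injective f
  surj : Surjective g
  exact : ∀ y : Y.carrier, g y = 0 ↔ ∃ x, f x = y
  f_graded : ∀ (i : ℤ), ∀ x ∈ X.grading i, f x ∈ Y.grading i
  g_graded : ∀ (i : ℤ), ∀ y ∈ Y.grading i, g y ∈ Z.grading i

end Graded

/-- The defining relations of the Grothendieck group of finite-dimensional graded modules. -/
def grRelSet (A : Type u) [CommRing A] (H : Type u) [Ring H] [Algebra A H]
    (𝒜 : ℤ → Submodule A H) (S : Type u) [CommRing S] [Algebra A S] :
    Set (FreeAbelianGroup (GrMod A H 𝒜 S)) :=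
  { z | ∃ X Y Z : GrMod A H 𝒜 S, Nonempty (GrSES X Y Z) ∧
      z = FreeAbelianGroup.of Y - FreeAbelianGroup.of X - FreeAbelianGroup.of Z }

/-- The Grothendieck group `R_0(S ⊗_A H)` of finite-dimensional graded modules. -/
def Groth (A : Type u) [CommRing A] (H : Type u) [Ring H] [Algebra A H]
    (𝒜 : ℤ → Submodule A H) (S : Type u) [CommRing S] [Algebra A S] : Type (u + 1) :=
  FreeAbelianGroup (GrMod A H 𝒜 S) ⧸ AddSubgroup.closure (grRelSet A H 𝒜 S)

noncomputable instance (A : Type u) [CommRing A] (H : Type u) [Ring H] [Algebra A H]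
    (𝒜 : ℤ → Submodule A H) (S : Type u) [CommRing S] [Algebra A S] :
    AddCommGroup (Groth A H 𝒜 S) :=
  inferInstanceAs
    (AddCommGroup (FreeAbelianGroup (GrMod A H 𝒜 S) ⧸ AddSubgroup.closure (grRelSet A H 𝒜 S)))

/-- The class `[V]` of a graded module in the Grothendieck group; `R_0^+` is the set of
all such classes. -/
def GrMod.cls {A : Type u} [CommRing A] {H : Type u} [Ring H] [Algebra A H]
    {𝒜 : ℤ → Submodule A H} {S : Type u} [CommRing S] [Algebra A S]
    (V : GrMod A H 𝒜 S) : Groth A H 𝒜 S :=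
  QuotientAddGroup.mk (FreeAbelianGroup.of V)

section Char

variable {A : Type u} [CommRing A] {H : Type u} [Ring H] [Algebra A H]
  {𝒜 : ℤ → Submodule A H} {S : Type u} [CommRing S] [Algebra A S]

/-- The graded character of a graded module, as a function `H → S[t,t⁻¹]`:
it vanishes on the components of degree `≠ 0` and sends `h₀ ∈ H_0` to
`∑_i t^i χ_{V_i}(h₀)`. -/
noncomputable def GrMod.grChar [DirectSum.Decomposition 𝒜] (V : GrMod A H 𝒜 S) :
    H → LaurentPolynomial S :=
  fun h => ∑ᶠ i : ℤ, LaurentPolynomial.T i *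
    LaurentPolynomial.C
      (LinearMap.trace S (V.grading i) (V.degAct (DirectSum.decompose 𝒜 h 0) i))

/-- The set of irreducible graded characters `{χ^gr_{M⟨j⟩}}`: graded characters of graded
modules whose underlying ungraded module is simple (the grading of a simple module being
unique up to shift). -/
def IrrGrChars (A : Type u) [CommRing A] (H : Type u) [Ring H] [Algebra A H]
    (𝒜 : ℤ → Submodule A H) [DirectSum.Decomposition 𝒜]
    (S : Type u) [CommRing S] [Algebra A S] : Set (H → LaurentPolynomial S) :=
  { χ | ∃ V : GrMod A H 𝒜 S, V.forget.Simple ∧ χ = V.grChar }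

end Char

section FieldCoeffs

variable {A : Type u} [CommRing A] {H : Type u} [Ring H] [Algebra A H]
  {𝒜 : ℤ → Submodule A H} {F : Type u} [Field F] [Algebra A F]

/-- The characteristic polynomial of the action of a degree-`0` element of `H` on the
degree-`i` piece of a graded module. -/
noncomputable def GrMod.cpoly (V : GrMod A H 𝒜 F) (h : 𝒜 0) (i : ℤ) : Polynomial F :=
  LinearMap.charpoly (V.degAct h i)

/-- `L` is a graded `O ⊗_A H`-lattice in the graded `F ⊗_A H`-module `V`: an `O`-submodule,
stable under `H`, graded, finitely generated and free over `O`, any `O`-basis of which is an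
`F`-basis of `V`. -/
def GrMod.IsLattice (O : ValuationSubring F) (V : GrMod A H 𝒜 F)
    (L : AddSubgroup V.carrier) : Prop :=
  (∀ c : F, c ∈ O → ∀ x ∈ L, c • x ∈ L) ∧
  (∀ h : H, ∀ x ∈ L, h • x ∈ L) ∧
  (∀ x ∈ L, ∀ i : ℤ, ((DirectSum.decompose V.grading x i : V.grading i) : V.carrier) ∈ L) ∧
  ∃ (n : ℕ) (b : Fin n → V.carrier),
    LinearIndependent F b ∧ Submodule.span F (Set.range b) = ⊤ ∧ (∀ m, b m ∈ L) ∧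
    (∀ x ∈ L, ∃ c : Fin n → F, (∀ m, c m ∈ O) ∧ x = ∑ m, c m • b m)

/-- The subgroup `J(O)·L` of a lattice `L`, where `J(O)` is the maximal ideal
(= nonunits) of the valuation ring `O`. -/
def GrMod.mSub (O : ValuationSubring F) (V : GrMod A H 𝒜 F)
    (L : AddSubgroup V.carrier) : AddSubgroup V.carrier :=
  AddSubgroup.closure { z | ∃ c : O, ¬ IsUnit c ∧ ∃ y ∈ L, z = (c : F) • y }

/-- `φ` exhibits the graded `k ⊗_A H`-module `Y` as the modular reduction `k ⊗_O L` of the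
graded `O ⊗_A H`-lattice `L`, along the surjection `π : O → k` onto the residue field. -/
def GrMod.Reduces {k : Type u} [Field k] [Algebra A k]
    (O : ValuationSubring F) (π : O →+* k)
    (V : GrMod A H 𝒜 F) (L : AddSubgroup V.carrier)
    (Y : GrMod A H 𝒜 k) (φ : L →+ Y.carrier) : Prop :=
  Surjective φ ∧
  (∀ x : L, φ x = 0 ↔ (x : V.carrier) ∈ GrMod.mSub O V L) ∧
  (∀ (c : O) (x y : L), (y : V.carrier) = (c : F) • (x : V.carrier) → φ y = π c • φ x) ∧
  (∀ (h : H) (x y : L), (y : V.carrier) = h • (x : V.carrier) → φ y = h • φ x) ∧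
  (∀ (i : ℤ) (x : L), (x : V.carrier) ∈ V.grading i → φ x ∈ Y.grading i) ∧
  (∀ i : ℤ, ∀ y ∈ Y.grading i, ∃ x : L, (x : V.carrier) ∈ V.grading i ∧ φ x = y)

end FieldCoeffs

section Helpers

theorem hlp_iso_of_ann {R H V W : Type*} [Field R] [Ring H] [Algebra R H]
    [AddCommGroup V] [Module H V]
    [AddCommGroup W] [Module R W] [Module H W] [IsScalarTower R H W] [Module.Finite R W]
    [IsSimpleModule H V] [IsSimpleModule H W]
    (v : V) (hv : v ≠ 0) (hann : ∀ h : H, (∀ w : W, h • w = 0) → h • v = 0) :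
    Nonempty (W ≃ₗ[H] V) := by
  classical
  let b := Module.finBasis R W
  let f : H →ₗ[H] (Fin (Module.finrank R W) → W) :=
    LinearMap.pi fun i => LinearMap.toSpanSingleton H W (b i)
  let g : H →ₗ[H] V := LinearMap.toSpanSingleton H V v
  have : SMulCommClass R H W := IsScalarTower.to_smulCommClass
  have hker : LinearMap.ker f ≤ LinearMap.ker g := by
    intro h hh
    have hh' : ∀ i, h • b i = 0 := fun i => by
      have := congrFun (LinearMap.mem_ker.1 hh) i
      simpa [f] using this
    have : ∀ w : W, h • w = 0 := by
      intro w
      rw [← b.sum_repr w, Finset.smul_sum]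
      refine Finset.sum_eq_zero fun i _ => ?_
      rw [← smul_comm, hh', smul_zero]
    simpa [g] using hann h this
  let f' := (LinearMap.ker f).liftQ f le_rfl
  let g' := (LinearMap.ker f).liftQ g hker
  have hf' : Function.Injective f' := by
    rw [← LinearMap.ker_eq_bot]
    exact Submodule.ker_liftQ_eq_bot _ _ _ le_rfl
  obtain ⟨k, hk⟩ := IsSemisimpleModule.extension_property f' hf' g'
  have h1 : k (f 1) = v := by
    have := LinearMap.congr_fun hk (Submodule.Quotient.mk 1)
    simpa [f', g', g] using this
  by_contra hcon
  have hz : ∀ i, k ∘ₗ LinearMap.single H (fun _ => W) i = 0 := by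
    intro i
    by_contra hne
    exact hcon ⟨LinearEquiv.ofBijective _ (LinearMap.bijective_of_ne_zero hne)⟩
  have hk0 : k = 0 := by
    refine LinearMap.pi_ext' fun i => ?_
    rw [hz i]; simp
  exact hv (by rw [← h1, hk0]; simp)

theorem hlp_iso_of_trace {R H V W : Type*} [Field R] [Ring H] [Algebra R H]
    [AddCommGroup V] [Module R V] [Module H V] [IsScalarTower R H V] [Module.Finite R V]
    [AddCommGroup W] [Module R W] [Module H W] [IsScalarTower R H W] [Module.Finite R W]
    [IsSimpleModule H V] [IsSimpleModule H W]
    (htr : ∀ h : H, LinearMap.trace R V (Algebra.lsmul R R V h)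
      = LinearMap.trace R W (Algebra.lsmul R R W h))
    (h0 : ∃ h : H, LinearMap.trace R V (Algebra.lsmul R R V h) ≠ 0) :
    Nonempty (V ≃ₗ[H] W) := by
  by_cases htop : Module.annihilator H V ⊔ Module.annihilator H W = ⊤
  · exfalso
    have h1 : (1 : H) ∈ Module.annihilator H V ⊔ Module.annihilator H W := by rw [htop]; trivial
    obtain ⟨a, ha, b, hb, hab⟩ := Submodule.mem_sup.1 h1
    obtain ⟨x, hx⟩ := h0
    apply hx
    have e1 : Algebra.lsmul R R V x = Algebra.lsmul R R V (x * b) := by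
      ext v
      have hav : a • v = 0 := Module.mem_annihilator.1 ha v
      have : x • v = x • (a + b) • v := by rw [hab, one_smul]
      simp only [Algebra.lsmul_coe]
      rw [this, add_smul, hav, zero_add, mul_smul]
    have e2 : Algebra.lsmul R R W (x * b) = 0 := by
      ext w
      have hbw : b • w = 0 := Module.mem_annihilator.1 hb w
      simp only [Algebra.lsmul_coe]
      rw [mul_smul, hbw, smul_zero]; rfl
    rw [e1, htr, e2, map_zero]
  · obtain ⟨m, hm, hle⟩ := Ideal.exists_le_maximal _ htop
    have : IsSimpleModule H (H ⧸ m) := isSimpleModule_iff_isCoatom.2 hm.1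
    have hne : (Submodule.Quotient.mk 1 : H ⧸ m) ≠ 0 := by
      rw [Ne, Submodule.Quotient.mk_eq_zero]
      exact fun h => hm.ne_top ((Ideal.eq_top_iff_one m).2 h)
    have key : ∀ h ∈ m, h • (Submodule.Quotient.mk 1 : H ⧸ m) = 0 := by
      intro h hh
      rw [← Submodule.Quotient.mk_smul, Submodule.Quotient.mk_eq_zero]
      simpa using hh
    obtain ⟨e1⟩ := hlp_iso_of_ann (R := R) (W := V) _ hne fun h hh =>
      key h (hle (Submodule.mem_sup_left (Module.mem_annihilator.2 hh)))
    obtain ⟨e2⟩ := hlp_iso_of_ann (R := R) (W := W) _ hne fun h hh =>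
      key h (hle (Submodule.mem_sup_right (Module.mem_annihilator.2 hh)))
    exact ⟨e1.trans e2.symm⟩

open LaurentPolynomial in
theorem hlp_dvd {K : Type*} [Field K] (f : LaurentPolynomial K)
    (hf : LaurentPolynomial.eval₂ (RingHom.id K) (1 : Kˣ) f = 0) :
    (T 1 - 1 : LaurentPolynomial K) ∣ f := by
  obtain ⟨n, p, hp⟩ := f.exists_T_pow
  have h1 : p.IsRoot 1 := by
    have := congrArg (LaurentPolynomial.eval₂ (RingHom.id K) (1 : Kˣ)) hp
    rw [map_mul, hf, zero_mul, eval₂_toLaurent] at this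
    rw [Units.val_one] at this
    exact this
  obtain ⟨q, hq⟩ := Polynomial.dvd_iff_isRoot.2 h1
  refine ⟨Polynomial.toLaurent q * T (-n), ?_⟩
  have h2 : f = f * T n * T (-n) := by rw [mul_T_assoc]; simp
  rw [h2, ← hp, hq]
  simp [mul_assoc]

open LaurentPolynomial in
theorem hlp_lin {K ι X : Type*} [Field K] (c : ι → X → LaurentPolynomial K)
    (hc : LinearIndependent K
      (fun i x => LaurentPolynomial.eval₂ (RingHom.id K) (1 : Kˣ) (c i x))) :
    LinearIndependent (LaurentPolynomial K) c := by
  classical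
  have : IsNoetherianRing (LaurentPolynomial K) :=
    IsLocalization.isNoetherianRing (Submonoid.powers (Polynomial.X : Polynomial K)) _ inferInstance
  have : IsDomain (LaurentPolynomial K) :=
    IsLocalization.isDomain_of_le_nonZeroDivisors (M := Submonoid.powers (Polynomial.X : Polynomial K))
      _ (powers_le_nonZeroDivisors_of_noZeroDivisors Polynomial.X_ne_zero)
  set ε := LaurentPolynomial.eval₂ (RingHom.id K) (1 : Kˣ) with hε
  have hne : (T 1 - 1 : LaurentPolynomial K) ≠ 0 := by
    intro h
    have h' : (T 1 : LaurentPolynomial K) = T 0 := (sub_eq_zero.1 h).trans T_zero.symm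
    have := congrArg (fun f : LaurentPolynomial K => f.coeff 1) h'
    simp only [T_apply] at this
    simp at this
  have hnu : ¬ IsUnit (T 1 - 1 : LaurentPolynomial K) := by
    intro h
    have := h.map ε
    rw [map_sub, map_one, hε, eval₂_T] at this
    simp at this
  rw [linearIndependent_iff']
  intro s
  have key : ∀ n : ℕ, ∀ l : ι → LaurentPolynomial K, ∑ i ∈ s, l i • c i = 0 →
      ∀ i ∈ s, (T 1 - 1 : LaurentPolynomial K) ^ n ∣ l i := by
    intro n
    induction n with
    | zero => intro l _ i _; simp
    | succ n ih =>
      intro l hl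
      have h1 : ∀ i ∈ s, ε (l i) = 0 := by
        refine linearIndependent_iff'.1 hc s (fun i => ε (l i)) ?_
        funext x
        have := congrArg ε (congrFun hl x)
        simpa [Finset.sum_apply] using this
      have h2 : ∀ i, ∃ m, i ∈ s → l i = (T 1 - 1) * m := by
        intro i
        by_cases hi : i ∈ s
        · obtain ⟨m, hm⟩ := hlp_dvd _ (h1 i hi)
          exact ⟨m, fun _ => hm⟩
        · exact ⟨0, fun h => absurd h hi⟩
      choose m hm using h2
      have h3 : ∑ i ∈ s, m i • c i = 0 := by
        funext x
        have := congrFun hl x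
        rw [Finset.sum_apply] at this ⊢
        have h4 : (T 1 - 1) * ∑ i ∈ s, (m i • c i) x = 0 := by
          rw [← this.trans (Pi.zero_apply x), Finset.mul_sum]
          refine Finset.sum_congr rfl fun i hi => ?_
          simp [hm i hi, mul_assoc]
        exact (mul_eq_zero.1 h4).resolve_left hne
      intro i hi
      rw [hm i hi, pow_succ']
      exact mul_dvd_mul_left _ (ih m h3 i hi)
  intro l hl i hi
  by_contra h0
  obtain ⟨n, hn⟩ := FiniteMultiplicity.of_not_isUnit hnu h0
  exact hn (key (n + 1) l hl i hi)

open LaurentPolynomial in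
theorem hlp_comb {K X : Type*} [Field K] (P : Set (X → LaurentPolynomial K))
    (Q : Set (X → K)) (hQ : LinearIndependent K (Subtype.val : Q → (X → K)))
    (hPQ : ∀ f ∈ P, (fun x => LaurentPolynomial.eval₂ (RingHom.id K) (1 : Kˣ) (f x)) ∈ Q)
    (hsh : ∀ f ∈ P, ∀ g ∈ P,
      (fun x => LaurentPolynomial.eval₂ (RingHom.id K) (1 : Kˣ) (f x)) =
      (fun x => LaurentPolynomial.eval₂ (RingHom.id K) (1 : Kˣ) (g x)) →
      ∃ d : ℤ, ∀ x, g x = T d * f x) :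
    LinearIndependent K (Subtype.val : P → (X → LaurentPolynomial K)) := by
  classical
  let u : P → Q := fun f => ⟨_, hPQ f.1 f.2⟩
  let ι := Set.range u
  have hr : ∀ i : ι, ∃ f : P, u f = i.1 := fun i => i.2
  choose r hr using hr
  have hlin : LinearIndependent (LaurentPolynomial K) (fun i : ι => (r i).1) := by
    apply hlp_lin
    have h2 := hQ.comp (fun i : ι => i.1) Subtype.val_injective
    convert h2 using 1
    funext i
    exact congrArg Subtype.val (hr i)
  have hT : LinearIndependent K (fun d : ℤ => (T d : LaurentPolynomial K)) := by
    rw [linearIndependent_iff']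
    intro s g hg d hd
    have := congrArg (fun f : LaurentPolynomial K => f.coeff d) hg
    simpa [hd] using this
  have hprod := linearIndependent_smul hT hlin
  have hd : ∀ f : P, ∃ d : ℤ, ∀ x, f.1 x = T d * (r ⟨u f, f, rfl⟩).1 x := by
    intro f
    refine hsh _ (r ⟨u f, f, rfl⟩).2 _ f.2 ?_
    exact congrArg Subtype.val (hr ⟨u f, f, rfl⟩)
  choose d hd using hd
  have heq : (Subtype.val : P → (X → LaurentPolynomial K)) =
      (fun p : ℤ × ι => (T p.1 : LaurentPolynomial K) • (r p.2).1) ∘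
        (fun f => (d f, ⟨u f, f, rfl⟩)) := by
    funext f x
    exact hd f x
  have hinj : Function.Injective (fun f : P => ((d f, ⟨u f, f, rfl⟩) : ℤ × ι)) := by
    intro f g hfg
    apply Subtype.ext
    rw [heq]
    exact congrArg (fun p : ℤ × ι => (T p.1 : LaurentPolynomial K) • (r p.2).1) hfg
  rw [heq]
  exact hprod.comp _ hinj

variable {R : Type u} [Field R] {H : Type u} [Ring H] [Algebra R H]
  {𝒜 : ℤ → Submodule R H}

theorem hlp_tower (M : ModPkg R H R) : IsScalarTower R H M.carrier where
  smul_assoc a h x := by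
    rw [Algebra.smul_def, mul_smul, M.compat]; rfl

theorem hlp_simple (M : ModPkg R H R) (hM : M.Simple) : IsSimpleModule H M.carrier := by
  obtain ⟨h1, h2⟩ := hM
  rw [isSimpleModule_iff]
  exact
  { exists_pair_ne := ⟨⊥, ⊤, by
      intro h
      obtain ⟨x, hx⟩ := exists_ne (0 : M.carrier)
      have : x ∈ (⊥ : Submodule H M.carrier) := by rw [h]; trivial
      exact hx (by simpa using this)⟩
    eq_bot_or_eq_top := by
      intro p
      have hs : ∀ (s : R), ∀ x ∈ p.toAddSubgroup, s • x ∈ p.toAddSubgroup := by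
        intro s x hx
        have := M.compat s x
        rw [Algebra.algebraMap_self, RingHom.id_apply] at this
        rw [← this]
        exact p.smul_mem _ hx
      rcases h2 p.toAddSubgroup ⟨hs, fun h x hx => p.smul_mem h hx⟩ with h | h
      · left
        exact Submodule.toAddSubgroup_injective h
      · right
        exact Submodule.toAddSubgroup_injective h }

theorem hlp_finite (V : GrMod R H 𝒜 R) : {i | V.grading i ≠ ⊥}.Finite :=
  WellFoundedGT.finite_ne_bot_of_iSupIndep
    (DirectSum.Decomposition.isInternal V.grading).submodule_iSupIndep

theorem hlp_support (V : GrMod R H 𝒜 R) (h : 𝒜 0) :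
    (Function.support fun i : ℤ => (LaurentPolynomial.T i : LaurentPolynomial R) *
      LaurentPolynomial.C (LinearMap.trace R (V.grading i) (V.degAct h i))) ⊆
      ((hlp_finite V).toFinset : Set ℤ) := by
  intro i hi
  simp only [Set.Finite.coe_toFinset, Set.mem_ofPred_eq]
  intro hbot
  apply hi
  have : Subsingleton (V.grading i) := by rw [hbot]; infer_instance
  have h0 : V.degAct h i = 0 := Subsingleton.elim _ _
  simp [h0]

theorem hlp_char [GradedAlgebra 𝒜] (V : GrMod R H 𝒜 R) (h : H) :
    LaurentPolynomial.eval₂ (RingHom.id R) (1 : Rˣ) (V.grChar h) = V.forget.char h := by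
  classical
  have hI := DirectSum.Decomposition.isInternal V.grading
  have hact : ∀ x y : H, V.forget.act (x + y) = V.forget.act x + V.forget.act y := by
    intro x y
    ext v
    exact add_smul x y v
  let τ : H →+ R :=
    { toFun := fun x => V.forget.char x
      map_zero' := by
        have : V.forget.act (0 : H) = 0 := by
          ext v
          exact zero_smul H v
        simp [ModPkg.char, this]
      map_add' := by
        intro x y
        simp [ModPkg.char, hact] }
  have hz : ∀ k : ℤ, k ≠ 0 → ∀ x ∈ 𝒜 k, τ x = 0 := by
    intro k hk x hx
    refine LinearMap.trace_eq_zero_of_mapsTo_ne hI (fun i => k + i) (fun i => ?_) (fun i v hv => ?_)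
    · simpa using hk
    · exact V.grading_smul k i x hx v hv
  have hτ : τ h = τ (DirectSum.decompose 𝒜 h 0 : H) := by
    conv_lhs => rw [← DirectSum.sum_support_decompose 𝒜 h]
    rw [map_sum]
    by_cases h0 : (0 : ℤ) ∈ (DirectSum.decompose 𝒜 h).support
    · rw [Finset.sum_eq_single_of_mem 0 h0]
      intro k _ hk
      exact hz k hk _ (DirectSum.decompose 𝒜 h k).2
    · rw [DFinsupp.notMem_support_iff.1 h0, Finset.sum_eq_zero]
      · simp
      · intro k hk
        refine hz k ?_ _ (DirectSum.decompose 𝒜 h k).2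
        rintro rfl
        exact h0 hk
  change _ = τ h
  rw [hτ]
  set h0 := DirectSum.decompose 𝒜 h 0 with hh0
  let A0 : V.carrier →ₗ[R] V.carrier := V.forget.act (h0 : H)
  have hmap : ∀ i, Set.MapsTo A0 (V.grading i) (V.grading i) := by
    intro i v hv
    have := V.grading_smul 0 i (h0 : H) h0.2 v hv
    rwa [zero_add] at this
  have htr := LinearMap.trace_eq_sum_trace_restrict' hI (hlp_finite V) hmap
  change _ = LinearMap.trace R V.carrier (V.forget.act (h0 : H))
  refine Eq.trans ?_ htr.symm
  unfold GrMod.grChar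
  rw [finsum_eq_sum_of_support_subset _ (hlp_support V h0), map_sum]
  refine Finset.sum_congr rfl fun i _ => ?_
  rw [map_mul, LaurentPolynomial.eval₂_T, LaurentPolynomial.eval₂_C]
  simp only [one_zpow, Units.val_one, one_mul, RingHom.id_apply]
  rfl

theorem hlp_shift [GradedAlgebra 𝒜] (V W : GrMod R H 𝒜 R)
    (hV : IsSimpleModule H V.carrier) (hW : IsSimpleModule H W.carrier)
    (e : V.carrier ≃ₗ[H] W.carrier) :
    ∃ d : ℤ, ∀ h, W.grChar h = LaurentPolynomial.T d * V.grChar h := by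
  classical
  have tV : IsScalarTower R H V.carrier := hlp_tower V.forget
  have tW : IsScalarTower R H W.carrier := hlp_tower W.forget
  let eR : V.carrier →ₗ[R] W.carrier := e.toLinearMap.restrictScalars R
  let pr : ∀ k : ℤ, W.carrier →ₗ[R] W.carrier := fun k =>
    (W.grading k).subtype ∘ₗ DirectSum.component R ℤ (fun i => W.grading i) k ∘ₗ
      (DirectSum.decomposeLinearEquiv W.grading).toLinearMap
  have hpr : ∀ k w, pr k w = (DirectSum.decompose W.grading w k : W.carrier) := fun k w => rfl
  let E : ℤ → V.carrier →ₗ[R] W.carrier := fun d =>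
    (DirectSum.toModule R ℤ W.carrier
      fun i => pr (i + d) ∘ₗ eR ∘ₗ (V.grading i).subtype) ∘ₗ
      (DirectSum.decomposeLinearEquiv V.grading).toLinearMap
  have hE : ∀ d i v, v ∈ V.grading i →
      E d v = (DirectSum.decompose W.grading (e v) (i + d) : W.carrier) := by
    intro d i v hv
    have h1 : DirectSum.decompose V.grading v = DirectSum.lof R ℤ (fun i => V.grading i) i ⟨v, hv⟩ :=
      DirectSum.decompose_of_mem _ hv
    have : E d v = (DirectSum.toModule R ℤ W.carrier
      fun i => pr (i + d) ∘ₗ eR ∘ₗ (V.grading i).subtype) (DirectSum.decompose V.grading v) := rfl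
    rw [this, h1, DirectSum.toModule_lof]
    rfl
  have hmem : ∀ d i v, v ∈ V.grading i → E d v ∈ W.grading (i + d) := by
    intro d i v hv
    rw [hE d i v hv]
    exact Subtype.property _
  -- the component of `h • w` for homogeneous `h`
  have hcomp : ∀ (k j : ℤ) (x : H), x ∈ 𝒜 k → ∀ w : W.carrier,
      (DirectSum.decompose W.grading (x • w) (k + j) : W.carrier) =
        x • (DirectSum.decompose W.grading w j : W.carrier) := by
    intro k j x hx w
    induction w using DirectSum.Decomposition.inductionOn W.grading with
    | zero => simp
    | @homogeneous i m =>
      have h1 := W.grading_smul k i x hx m m.2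
      by_cases hij : i = j
      · subst hij
        rw [DirectSum.decompose_of_mem_same _ h1, DirectSum.decompose_of_mem_same _ m.2]
      · rw [DirectSum.decompose_of_mem_ne _ h1 (by simpa using hij),
          DirectSum.decompose_of_mem_ne _ m.2 hij, smul_zero]
    | add a b ha hb =>
      rw [smul_add, DirectSum.decompose_add, DirectSum.decompose_add]
      simp only [DirectSum.add_apply, Submodule.coe_add, ha, hb, smul_add]
  have hlin : ∀ d (x : H) v, E d (x • v) = x • E d v := by
    intro d x v
    induction v using DirectSum.Decomposition.inductionOn V.grading with
    | zero => simp
    | @homogeneous i m =>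
      induction x using DirectSum.Decomposition.inductionOn 𝒜 with
      | zero => simp
      | @homogeneous k y =>
        rw [hE d (k + i) _ (V.grading_smul k i y y.2 m m.2), hE d i m m.2, map_smul, add_assoc,
          hcomp k (i + d) y y.2]
      | add a b ha hb => rw [add_smul, map_add, ha, hb, add_smul]
    | add a b ha hb => rw [smul_add, map_add, ha, hb, map_add, smul_add]
  let EH : ℤ → V.carrier →ₗ[H] W.carrier := fun d =>
    { toFun := E d, map_add' := map_add (E d), map_smul' := hlin d }
  have hex : ∃ d, EH d ≠ 0 := by
    by_contra hcon
    push Not at hcon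
    have hall : ∀ v, e v = 0 := by
      intro v
      induction v using DirectSum.Decomposition.inductionOn V.grading with
      | zero => simp
      | @homogeneous i m =>
        apply (DirectSum.decompose W.grading).injective
        ext k
        have h1 : E (k - i) m = 0 := LinearMap.congr_fun (hcon (k - i)) (m : V.carrier)
        rw [hE (k - i) i m m.2, show i + (k - i) = k by ring] at h1
        simpa using h1
      | add a b ha hb => rw [map_add, ha, hb, add_zero]
    have : Nontrivial V.carrier := IsSimpleModule.nontrivial H V.carrier
    obtain ⟨x, hx⟩ := exists_ne (0 : V.carrier)
    exact hx (e.map_eq_zero_iff.1 (hall x))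
  obtain ⟨d, hd⟩ := hex
  have hbij : Function.Bijective (E d) := LinearMap.bijective_of_ne_zero (f := EH d) hd
  -- `E d` commutes with taking components
  have hcompE : ∀ v i, (DirectSum.decompose W.grading (E d v) (i + d) : W.carrier) =
      E d (DirectSum.decompose V.grading v i : V.carrier) := by
    intro v i
    induction v using DirectSum.Decomposition.inductionOn V.grading with
    | zero => simp
    | @homogeneous j m =>
      have h1 := hmem d j m m.2
      by_cases hij : j = i
      · subst hij
        rw [DirectSum.decompose_of_mem_same _ h1, DirectSum.decompose_of_mem_same _ m.2]
      · rw [DirectSum.decompose_of_mem_ne _ h1 (by simpa using hij),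
          DirectSum.decompose_of_mem_ne _ m.2 hij, map_zero]
    | add a b ha hb =>
      rw [map_add, DirectSum.decompose_add, DirectSum.decompose_add]
      simp only [DirectSum.add_apply, Submodule.coe_add, ha, hb, map_add]
  let Ei : ∀ i, V.grading i →ₗ[R] W.grading (i + d) := fun i =>
    (E d).restrict (fun v hv => hmem d i v hv)
  have hEi : ∀ i, Function.Bijective (Ei i) := by
    intro i
    constructor
    · intro x y hxy
      exact Subtype.ext (hbij.1 (congrArg Subtype.val hxy))
    · rintro ⟨w, hw⟩
      obtain ⟨v, rfl⟩ := hbij.2 w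
      refine ⟨DirectSum.decompose V.grading v i, Subtype.ext ?_⟩
      change E d (DirectSum.decompose V.grading v i : V.carrier) = E d v
      rw [← hcompE, DirectSum.decompose_of_mem_same _ hw]
  have htr : ∀ (x : 𝒜 0) i, LinearMap.trace R (W.grading (i + d)) (W.degAct x (i + d)) =
      LinearMap.trace R (V.grading i) (V.degAct x i) := by
    intro x i
    let ee := LinearEquiv.ofBijective (Ei i) (hEi i)
    rw [← LinearMap.trace_conj' (V.degAct x i) ee]
    congr 1
    ext w
    obtain ⟨v, rfl⟩ := ee.surjective w
    rw [LinearEquiv.conj_apply_apply, ee.symm_apply_apply]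
    exact (hlin d (x : H) (v : V.carrier)).symm
  refine ⟨d, fun h => ?_⟩
  unfold GrMod.grChar
  rw [mul_finsum' _ _ ((Finset.finite_toSet _).subset (hlp_support V _)),
    ← finsum_comp_equiv (Equiv.addRight d)]
  refine finsum_congr fun i => ?_
  change LaurentPolynomial.T (i + d) * LaurentPolynomial.C
    (LinearMap.trace R (W.grading (i + d))
      (W.degAct (DirectSum.decompose 𝒜 h 0) (i + d))) = _
  rw [htr, add_comm i d, LaurentPolynomial.T_add, mul_assoc]

end Helpers

/-- If the irreducible characters of the finite-dimensional `ℤ`-graded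
`R`-algebra `H` are linearly independent, then so are the irreducible graded characters. -/
theorem graded_characters_linearIndependent
    (R : Type u) [Field R] (H : Type u) [Ring H] [Algebra R H] [Module.Finite R H]
    (𝒜 : ℤ → Submodule R H) [GradedAlgebra 𝒜]
    (hIrr : LinearIndependent R (Subtype.val : IrrChars R H R → (H → R))) :
    LinearIndependent R
      (Subtype.val : IrrGrChars R H 𝒜 R → (H → LaurentPolynomial R)) := by
  refine hlp_comb _ _ hIrr ?_ ?_
  · rintro _ ⟨V, hV, rfl⟩
    exact ⟨V.forget, hV, funext fun h => hlp_char V h⟩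
  · rintro _ ⟨V, hV, rfl⟩ _ ⟨W, hW, rfl⟩ hVW
    have tV : IsScalarTower R H V.carrier := hlp_tower V.forget
    have tW : IsScalarTower R H W.carrier := hlp_tower W.forget
    have sV : IsSimpleModule H V.carrier := hlp_simple V.forget hV
    have sW : IsSimpleModule H W.carrier := hlp_simple W.forget hW
    have hne := hIrr.ne_zero ⟨V.forget.char, V.forget, hV, rfl⟩
    obtain ⟨e⟩ := hlp_iso_of_trace (R := R) (H := H) (V := V.carrier) (W := W.carrier)
      (fun h => by
        have := congrFun hVW h
        simp only [hlp_char] at this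
        exact this)
      (by
        obtain ⟨h, hh⟩ := Function.ne_iff.1 hne
        exact ⟨h, hh⟩)
    exact hlp_shift V W sV sW e
end

section
/- (Graded Brauer–Nesbitt Lemma.) Let R be a field and H a finite-dimensional associative Z-graded R-algebra such that the set Irr^gr(H) of irreducible graded characters is a linearly independent subset of Hom_R(H, R[t,t^{-1}]). If V = ⊕_{i∈Z} V_i and W = ⊕_{i∈Z} W_i are finite-dimensional graded H-modules such that for every h_0 ∈ H_0 and every i ∈ Z the characteristic polynomial of ρ_{V_i}(h_0) equals the characteristic polynomial of ρ_{W_i}(h_0), then V and W have the same graded composition factors with the same multiplicities (that is, [V] = [W] in the Grothendieck group of finite-dimensional graded H-modules). Equivalently, the map p_R : R_0^+(H) → Maps(H_0, R[X]^Z), p_R([V])(h_0) = (Poly(ρ_{V_i}(h_0)))_{i∈Z}, is injective. -/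
universe u

open DirectSum Function

lemma bn_charpoly_quot {R V : Type*} [Field R] [AddCommGroup V] [Module R V] [Module.Finite R V]
    (W : Submodule R V) (e : V →ₗ[R] V) (he : W ≤ W.comap e) :
    e.charpoly = (e.restrict he).charpoly * (W.mapQ W e he).charpoly := by
  classical
  let m := Module.Free.ChooseBasisIndex R W
  let bW : Module.Basis m R W := Module.Free.chooseBasis R W
  let n := Module.Free.ChooseBasisIndex R (V ⧸ W)
  let bQ : Module.Basis n R (V ⧸ W) := Module.Free.chooseBasis R (V ⧸ W)
  let b := Module.Basis.sumQuot bW bQ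
  let A : Matrix m m R := LinearMap.toMatrix bW bW (e.restrict he)
  let B : Matrix m n R := Matrix.of fun i l ↦
    ((Module.Basis.sumQuot bW bQ).repr (e ((Module.Basis.sumQuot bW bQ) (Sum.inr l)))) (Sum.inl i)
  let D : Matrix n n R := LinearMap.toMatrix bQ bQ (W.mapQ W e he)
  suffices LinearMap.toMatrix b b e = Matrix.fromBlocks A B 0 D by
    rw [← LinearMap.charpoly_toMatrix e b, this, ← LinearMap.charpoly_toMatrix _ bW,
      ← LinearMap.charpoly_toMatrix _ bQ, Matrix.charpoly_fromBlocks_zero₂₁]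
  ext u v
  cases u with
  | inl i =>
    cases v with
    | inl k =>
      simp only [b, Module.Basis.sumQuot_inl, Matrix.fromBlocks_apply₁₁, A, LinearMap.toMatrix_apply]
      apply Module.Basis.sumQuot_repr_inl_of_mem
    | inr l => simp [b, LinearMap.toMatrix_apply, Matrix.fromBlocks_apply₁₂, B]
  | inr j =>
    cases v with
    | inl k =>
      suffices W.mkQ (e (bW k)) = 0 by simp [LinearMap.toMatrix_apply, b, this]
      rw [← LinearMap.mem_ker, Submodule.ker_mkQ]
      exact he (Submodule.coe_mem (bW k))
    | inr l =>
      simp only [LinearMap.toMatrix_apply, Module.Basis.sumQuot_repr_inr,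
        Matrix.fromBlocks_apply₂₂, b, D]
      rw [← Module.Basis.sumQuot_inr bW bQ l, W.mapQ_apply]
      simp

lemma bn_charpoly_exact {R X Y Z : Type*} [Field R] [AddCommGroup X] [Module R X]
    [AddCommGroup Y] [Module R Y] [AddCommGroup Z] [Module R Z]
    [Module.Finite R X] [Module.Finite R Y] [Module.Finite R Z]
    (f : X →ₗ[R] Y) (g : Y →ₗ[R] Z) (hf : Injective f) (hg : Surjective g)
    (hfg : ∀ y, g y = 0 ↔ ∃ x, f x = y)
    (a : X →ₗ[R] X) (b : Y →ₗ[R] Y) (c : Z →ₗ[R] Z)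
    (hab : ∀ x, f (a x) = b (f x)) (hbc : ∀ y, g (b y) = c (g y)) :
    b.charpoly = a.charpoly * c.charpoly := by
  have he : LinearMap.ker g ≤ (LinearMap.ker g).comap b := by
    intro y hy
    simp only [LinearMap.mem_ker, Submodule.mem_comap] at *
    rw [hbc, hy, map_zero]
  rw [bn_charpoly_quot (LinearMap.ker g) b he]
  congr 1
  · let f' : X →ₗ[R] LinearMap.ker g := f.codRestrict _ (fun x => (hfg _).2 ⟨x, rfl⟩)
    have hf' : Bijective f' := by
      constructor
      · intro x y h
        exact hf (congrArg Subtype.val h)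
      · rintro ⟨y, hy⟩
        obtain ⟨x, hx⟩ := (hfg y).1 hy
        exact ⟨x, Subtype.ext hx⟩
    let e := LinearEquiv.ofBijective f' hf'
    rw [← LinearEquiv.charpoly_conj e a]
    congr 1
    ext y
    obtain ⟨x, rfl⟩ := e.surjective y
    simp only [LinearEquiv.conj_apply_apply, LinearEquiv.symm_apply_apply]
    exact (hab x).symm
  · let e := g.quotKerEquivOfSurjective hg
    rw [← LinearEquiv.charpoly_conj e]
    congr 1
    ext z
    obtain ⟨y, rfl⟩ := hg z
    have : e.symm (g y) = Submodule.Quotient.mk y := by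
      rw [LinearEquiv.symm_apply_eq]; rfl
    rw [LinearEquiv.conj_apply_apply, this]
    exact hbc y

lemma bn_sep {A K M N : Type*} [Ring A] [Field K] [AddCommGroup M] [AddCommGroup N]
    [Module A M] [Module A N] [Module K M] [Module K N] [SMulCommClass A K M] [SMulCommClass A K N]
    [Module.Finite K M] [Module.Finite K N] [IsSimpleModule A M] [IsSimpleModule A N]
    (hno : ∀ f : M →ₗ[A] N, ¬ Bijective f) :
    ∃ a : A, (∀ m : M, a • m = m) ∧ ∀ n : N, a • n = 0 := by
  classical
  have h1 : ∀ f : M →ₗ[A] N, f = 0 := fun f => by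
    by_contra h
    exact hno f (LinearMap.bijective_of_ne_zero h)
  have h2 : ∀ f : N →ₗ[A] M, f = 0 := fun f => by
    by_contra h
    exact hno _ (LinearEquiv.ofBijective f (LinearMap.bijective_of_ne_zero h)).symm.bijective
  have : IsSemisimpleModule A (M × N) := by
    have h := IsSemisimpleModule.sup (IsSemisimpleModule.range (LinearMap.inl A M N))
      (IsSemisimpleModule.range (LinearMap.inr A M N))
    rw [LinearMap.sup_range_inl_inr] at h
    exact IsSemisimpleModule.congr Submodule.topEquiv.symm
  let P : Module.End (Module.End A (M × N)) (M × N) :=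
    { toFun := fun x => (x.1, 0)
      map_add' := by intro x y; simp
      map_smul' := by
        intro g x
        obtain ⟨m, n⟩ := x
        have e1 : (g (m, 0)).2 = 0 := by
          simpa using LinearMap.congr_fun (h1 ((LinearMap.snd A M N).comp (g.comp (LinearMap.inl A M N)))) m
        have e2 : (g (0, n)).1 = 0 := by
          simpa using LinearMap.congr_fun (h2 ((LinearMap.fst A M N).comp (g.comp (LinearMap.inr A M N)))) n
        have e3 : g (m, n) = g (m, 0) + g (0, n) := by rw [← map_add]; simp
        simp only [Module.End.smul_def, RingHom.id_apply, e3]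
        ext <;> simp [e1, e2] }
  obtain ⟨s, hs⟩ := Module.Finite.fg_top (R := K) (M := M × N)
  obtain ⟨a, ha⟩ := jacobson_density P s
  have key : ∀ x : M × N, P x = a • x := by
    intro x
    induction hs.ge (trivial : x ∈ ⊤) using Submodule.span_induction with
    | mem m hm => exact ha m hm
    | zero => simp
    | add _ _ _ _ h₁ h₂ => rw [map_add, smul_add, h₁, h₂]
    | smul k x _ h =>
      rw [smul_comm, ← h]
      change ((k • x).1, (0:N)) = k • (x.1, (0 : N))
      simp
  refine ⟨a, fun m => ?_, fun n => ?_⟩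
  · exact (congrArg Prod.fst (key (m, 0))).symm
  · exact (congrArg Prod.snd (key (0, n))).symm

section BNGraded

variable {R : Type u} [Field R] {H : Type u} [Ring H] [Algebra R H]
  {𝒜 : ℤ → Submodule R H}

instance bnTower (V : GrMod R H 𝒜 R) : IsScalarTower R H V.carrier where
  smul_assoc a h x := by
    rw [Algebra.smul_def, mul_smul, V.compat, Algebra.algebraMap_self, RingHom.id_apply]

instance bnComm (V : GrMod R H 𝒜 R) : SMulCommClass H R V.carrier where
  smul_comm h a x := V.smul_comm' h a x

/-- Projection to the degree `i` component. -/
noncomputable def bnPr (V : GrMod R H 𝒜 R) (i : ℤ) : V.carrier →ₗ[R] V.carrier :=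
  (V.grading i).subtype.comp ((DirectSum.component R ℤ (fun i => V.grading i) i).comp
    (decomposeLinearEquiv V.grading).toLinearMap)

lemma bnPr_apply (V : GrMod R H 𝒜 R) (i : ℤ) (x : V.carrier) :
    bnPr V i x = ((decompose V.grading x i : V.grading i) : V.carrier) := rfl

lemma bnPr_mem (V : GrMod R H 𝒜 R) (i : ℤ) (x : V.carrier) : bnPr V i x ∈ V.grading i :=
  (decompose V.grading x i).2

lemma bnPr_same (V : GrMod R H 𝒜 R) {i : ℤ} {x : V.carrier} (hx : x ∈ V.grading i) :
    bnPr V i x = x := decompose_of_mem_same V.grading hx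

lemma bnPr_ne (V : GrMod R H 𝒜 R) {i j : ℤ} {x : V.carrier} (hx : x ∈ V.grading i)
    (h : i ≠ j) : bnPr V j x = 0 := decompose_of_mem_ne V.grading hx h

/-- Any additive-closed property of an element follows from that of its components. -/
lemma bn_mem_of_comp (V : GrMod R H 𝒜 R) (P : AddSubmonoid V.carrier) (x : V.carrier)
    (h : ∀ i, bnPr V i x ∈ P) : x ∈ P := by
  classical
  rw [← sum_support_decompose V.grading x]
  exact sum_mem fun i _ => h i

lemma bn_eq_zero (V : GrMod R H 𝒜 R) (x : V.carrier) (h : ∀ i, bnPr V i x = 0) : x = 0 :=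
  bn_mem_of_comp V ⊥ x h

lemma bnPr_smul [GradedAlgebra 𝒜] (V : GrMod R H 𝒜 R) (h : H) {i : ℤ} {x : V.carrier}
    (hx : x ∈ V.grading i) (k : ℤ) :
    bnPr V k (h • x) = ((decompose 𝒜 h (k - i) : 𝒜 (k - i)) : H) • x := by
  induction h using DirectSum.Decomposition.inductionOn 𝒜 with
  | zero => simp
  | @homogeneous j m =>
    have hm := V.grading_smul j i m m.2 x hx
    by_cases hk : j + i = k
    · subst hk
      rw [bnPr_same V hm, add_sub_cancel_right, decompose_of_mem_same 𝒜 m.2]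
    · rw [bnPr_ne V hm hk, decompose_of_mem_ne 𝒜 m.2 (by omega), zero_smul]
  | add a b ha hb => simp [add_smul, ha, hb]

lemma bn_internal {M : Type*} [AddCommGroup M] [Module R M] (ℳ : ℤ → Submodule R M)
    (π : ℤ → M →ₗ[R] M) (h1 : ∀ i, ∀ x ∈ ℳ i, π i x = x)
    (h2 : ∀ i j, i ≠ j → ∀ x ∈ ℳ i, π j x = 0) (h3 : ∀ x, x ∈ ⨆ i, ℳ i) :
    DirectSum.IsInternal ℳ := by
  classical
  refine (DirectSum.isInternal_submodule_iff_iSupIndep_and_iSup_eq_top ℳ).2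
    ⟨?_, eq_top_iff.2 fun x _ => h3 x⟩
  intro i
  rw [Submodule.disjoint_def]
  intro x hx hxs
  have : (⨆ j, ⨆ (_ : j ≠ i), ℳ j) ≤ LinearMap.ker (π i) :=
    iSup_le fun j => iSup_le fun hj => fun y hy => h2 j i hj y hy
  rw [← h1 i x hx]
  exact this hxs

/-- Graded submodule as a graded module. -/
noncomputable def bnSub (V : GrMod R H 𝒜 R) (P : Submodule H V.carrier)
    (hP : ∀ x ∈ P, ∀ i, bnPr V i x ∈ P) : GrMod R H 𝒜 R where
  carrier := P
  smul_comm' h s x := Subtype.ext (V.smul_comm' h s x)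
  compat a x := Subtype.ext (V.compat a x)
  fin := inferInstanceAs (Module.Finite R (P.restrictScalars R))
  grading i := (V.grading i).comap (P.subtype.restrictScalars R)
  decomp := by
    refine DirectSum.IsInternal.chooseDecomposition _ (bn_internal _
      (fun i => (bnPr V i).restrict (p := P.restrictScalars R) (q := P.restrictScalars R)
        (fun x hx => hP x hx i)) ?_ ?_ ?_)
    · intro i x hx
      exact Subtype.ext (bnPr_same V hx)
    · intro i j hij x hx
      exact Subtype.ext (bnPr_ne V hx hij)
    · intro x
      classical
      have : x = ∑ i ∈ (decompose V.grading (x : V.carrier)).support,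
          (⟨bnPr V i x, hP x x.2 i⟩ : P) := by
        apply Subtype.ext
        rw [AddSubmonoidClass.coe_finsetSum]
        exact (sum_support_decompose V.grading (x : V.carrier)).symm
      rw [this]
      exact sum_mem fun i _ => Submodule.mem_iSup_of_mem i (bnPr_mem V i x)
  grading_smul i j h hh x hx := V.grading_smul i j h hh x hx

/-- Graded quotient module. -/
noncomputable def bnQuot (V : GrMod R H 𝒜 R) (P : Submodule H V.carrier)
    (hP : ∀ x ∈ P, ∀ i, bnPr V i x ∈ P) : GrMod R H 𝒜 R where
  carrier := V.carrier ⧸ P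
  smul_comm' h s x := by
    obtain ⟨x, rfl⟩ := P.mkQ_surjective x
    exact congrArg P.mkQ (V.smul_comm' h s x)
  compat a x := by
    obtain ⟨x, rfl⟩ := P.mkQ_surjective x
    exact congrArg P.mkQ (V.compat a x)
  fin := Module.Finite.of_surjective (P.mkQ.restrictScalars R) P.mkQ_surjective
  grading i := (V.grading i).map (P.mkQ.restrictScalars R)
  decomp := by
    let g := P.mkQ.restrictScalars R
    have hg : Surjective g := P.mkQ_surjective
    have hk : ∀ x, g x = 0 ↔ x ∈ P := fun x => Submodule.Quotient.mk_eq_zero P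
    let π : ℤ → (V.carrier ⧸ P) →ₗ[R] (V.carrier ⧸ P) := fun i =>
      ((LinearMap.ker g).liftQ (g.comp (bnPr V i)) (fun x hx =>
        (hk _).2 (hP x ((hk x).1 hx) i))).comp (g.quotKerEquivOfSurjective hg).symm.toLinearMap
    have hπ : ∀ i x, π i (g x) = g (bnPr V i x) := by
      intro i x
      have : (g.quotKerEquivOfSurjective hg).symm (g x) = Submodule.Quotient.mk x := by
        rw [LinearEquiv.symm_apply_eq]; rfl
      simp only [π, LinearMap.comp_apply, LinearEquiv.coe_coe, this]
      rfl
    refine DirectSum.IsInternal.chooseDecomposition _ (bn_internal _ π ?_ ?_ ?_)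
    · rintro i _ ⟨x, hx, rfl⟩
      exact (hπ i x).trans (congrArg g (bnPr_same V hx))
    · rintro i j hij _ ⟨x, hx, rfl⟩
      exact (hπ j x).trans ((congrArg g (bnPr_ne V hx hij)).trans (map_zero g))
    · intro y
      obtain ⟨x, rfl⟩ := hg y
      refine bn_mem_of_comp V ((⨆ i, (V.grading i).map g).comap g).toAddSubmonoid x fun i => ?_
      exact Submodule.mem_iSup_of_mem (p := fun i => (V.grading i).map g) i
        ⟨_, bnPr_mem V i x, rfl⟩
  grading_smul i j h hh y hy := by
    obtain ⟨x, hx, rfl⟩ := hy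
    exact ⟨h • x, V.grading_smul i j h hh x hx, rfl⟩

/-- The tautological short exact sequence. -/
noncomputable def bnSES (V : GrMod R H 𝒜 R) (P : Submodule H V.carrier)
    (hP : ∀ x ∈ P, ∀ i, bnPr V i x ∈ P) : GrSES (bnSub V P hP) V (bnQuot V P hP) where
  f := P.subtype.toAddMonoidHom
  g := P.mkQ.toAddMonoidHom
  f_smulS _ _ := rfl
  f_smulH _ _ := rfl
  g_smulS _ _ := rfl
  g_smulH _ _ := rfl
  inj := Subtype.val_injective
  surj := P.mkQ_surjective
  exact y := by
    refine (Submodule.Quotient.mk_eq_zero P).trans ⟨fun h => ⟨⟨y, h⟩, rfl⟩, ?_⟩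
    rintro ⟨x, rfl⟩
    exact x.2
  f_graded _ _ hx := hx
  g_graded _ y hy := ⟨y, hy, rfl⟩

lemma bn_hom_pr {X Y : GrMod R H 𝒜 R} (f : X.carrier →+ Y.carrier)
    (hf : ∀ (i : ℤ), ∀ x ∈ X.grading i, f x ∈ Y.grading i) (i : ℤ) (x : X.carrier) :
    f (bnPr X i x) = bnPr Y i (f x) := by
  refine bn_mem_of_comp X (AddMonoidHom.eqLocusM (f.comp (bnPr X i).toAddMonoidHom)
    ((bnPr Y i).toAddMonoidHom.comp f)) x fun j => ?_
  change f (bnPr X i (bnPr X j x)) = bnPr Y i (f (bnPr X j x))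
  have hm := bnPr_mem X j x
  by_cases h : j = i
  · subst h
    rw [bnPr_same X hm, bnPr_same Y (hf _ _ hm)]
  · rw [bnPr_ne X hm h, bnPr_ne Y (hf _ _ hm) h, map_zero]

lemma bn_cpoly_ses {X Y Z : GrMod R H 𝒜 R} (s : GrSES X Y Z) (h : 𝒜 0) (i : ℤ) :
    Y.cpoly h i = X.cpoly h i * Z.cpoly h i := by
  let f : X.grading i →ₗ[R] Y.grading i :=
    { toFun := fun x => ⟨s.f x, s.f_graded i x x.2⟩
      map_add' := fun x y => Subtype.ext (map_add s.f _ _)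
      map_smul' := fun a x => Subtype.ext (s.f_smulS a x) }
  let g : Y.grading i →ₗ[R] Z.grading i :=
    { toFun := fun x => ⟨s.g x, s.g_graded i x x.2⟩
      map_add' := fun x y => Subtype.ext (map_add s.g _ _)
      map_smul' := fun a x => Subtype.ext (s.g_smulS a x) }
  refine bn_charpoly_exact f g ?_ ?_ ?_ _ _ _ ?_ ?_
  · intro x y hxy
    exact Subtype.ext (s.inj (congrArg Subtype.val hxy))
  · rintro ⟨z, hz⟩
    obtain ⟨y, rfl⟩ := s.surj z
    refine ⟨⟨bnPr Y i y, bnPr_mem Y i y⟩, Subtype.ext ?_⟩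
    exact (bn_hom_pr s.g s.g_graded i y).trans (bnPr_same Z hz)
  · rintro ⟨y, hy⟩
    constructor
    · intro h0
      obtain ⟨x, rfl⟩ := (s.exact y).1 (congrArg Subtype.val h0)
      refine ⟨⟨bnPr X i x, bnPr_mem X i x⟩, Subtype.ext ?_⟩
      exact (bn_hom_pr s.f s.f_graded i x).trans (bnPr_same Y hy)
    · rintro ⟨x, hx⟩
      exact Subtype.ext ((s.exact y).2 ⟨x, congrArg Subtype.val hx⟩)
  · intro x
    exact Subtype.ext (s.f_smulH h x)
  · intro x
    exact Subtype.ext (s.g_smulH h x)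

lemma bn_finrank_ses {X Y Z : GrMod R H 𝒜 R} (s : GrSES X Y Z) :
    Module.finrank R Y.carrier = Module.finrank R X.carrier + Module.finrank R Z.carrier := by
  have := bn_charpoly_exact (R := R)
    { toFun := s.f, map_add' := map_add s.f, map_smul' := s.f_smulS }
    { toFun := s.g, map_add' := map_add s.g, map_smul' := s.g_smulS } s.inj s.surj s.exact
    0 0 0 (fun x => map_zero s.f) (fun y => map_zero s.g)
  have h := congrArg Polynomial.natDegree this
  rwa [(LinearMap.charpoly_monic _).natDegree_mul (LinearMap.charpoly_monic _),
    LinearMap.charpoly_natDegree, LinearMap.charpoly_natDegree, LinearMap.charpoly_natDegree] at h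

lemma bn_cls_ses {X Y Z : GrMod R H 𝒜 R} (s : GrSES X Y Z) : Y.cls = X.cls + Z.cls := by
  have h : (QuotientAddGroup.mk (FreeAbelianGroup.of Y - FreeAbelianGroup.of X -
      FreeAbelianGroup.of Z) : Groth R H 𝒜 R) = 0 :=
    (QuotientAddGroup.eq_zero_iff _).2 (AddSubgroup.subset_closure ⟨X, Y, Z, ⟨s⟩, rfl⟩)
  have h' : Y.cls - X.cls - Z.cls = 0 := h
  rw [sub_sub, sub_eq_zero] at h'
  exact h'

lemma bn_cls_zero {X : GrMod R H 𝒜 R} (hX : Subsingleton X.carrier) : X.cls = 0 := by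
  have s : GrSES X X X :=
    { f := 0, g := 0
      f_smulS := fun _ _ => Subsingleton.elim _ _
      f_smulH := fun _ _ => Subsingleton.elim _ _
      g_smulS := fun _ _ => Subsingleton.elim _ _
      g_smulH := fun _ _ => Subsingleton.elim _ _
      inj := fun _ _ _ => Subsingleton.elim _ _
      surj := fun x => ⟨x, Subsingleton.elim _ _⟩
      exact := fun y => ⟨fun _ => ⟨y, Subsingleton.elim _ _⟩, fun _ => Subsingleton.elim _ _⟩
      f_graded := fun i _ _ => zero_mem _
      g_graded := fun i _ _ => zero_mem _ }
  have := bn_cls_ses s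
  simpa using this

lemma bn_cpoly_zero {X : GrMod R H 𝒜 R} (hX : Subsingleton X.carrier) (h : 𝒜 0) (i : ℤ) :
    X.cpoly h i = 1 := by
  apply (LinearMap.charpoly_monic _).natDegree_eq_zero.1
  rw [LinearMap.charpoly_natDegree]
  exact Module.finrank_zero_of_subsingleton

lemma bn_iso {X Y : GrMod R H 𝒜 R} (hi : X.GrIso Y) :
    X.cls = Y.cls ∧ ∀ h i, X.cpoly h i = Y.cpoly h i := by
  obtain ⟨e, e1, e2, e3⟩ := hi
  let T := bnSub X ⊥ (fun x hx i => by
    rw [(Submodule.mem_bot H).1 hx, map_zero]; exact zero_mem _)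
  have hT : Subsingleton T.carrier := inferInstanceAs (Subsingleton (⊥ : Submodule H X.carrier))
  have s : GrSES T X Y :=
    { f := 0, g := e.toAddMonoidHom
      f_smulS := fun _ _ => by simp
      f_smulH := fun _ _ => by simp
      g_smulS := e1
      g_smulH := e2
      inj := fun _ _ _ => Subsingleton.elim _ _
      surj := e.surjective
      exact := fun y => ⟨fun h => ⟨0, ((AddEquiv.map_eq_zero_iff e).1 h).symm⟩, by
        rintro ⟨x, rfl⟩; simp⟩
      f_graded := fun i _ _ => zero_mem _
      g_graded := e3 }
  refine ⟨?_, fun h i => ?_⟩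
  · rw [bn_cls_ses s, bn_cls_zero hT, zero_add]
  · rw [bn_cpoly_ses s, bn_cpoly_zero hT, one_mul]

lemma bn_filtration (n : ℕ) : ∀ V : GrMod R H 𝒜 R, Module.finrank R V.carrier = n →
    ∃ L : Multiset (GrMod R H 𝒜 R), (∀ M ∈ L, M.GrSimple) ∧ V.cls = (L.map GrMod.cls).sum ∧
      ∀ h i, V.cpoly h i = (L.map fun M => M.cpoly h i).prod := by
  induction n using Nat.strong_induction_on with
  | _ n ih =>
    intro V hV
    rcases subsingleton_or_nontrivial V.carrier with hs | hn
    · exact ⟨0, by simp, by simpa using bn_cls_zero hs, by simpa using bn_cpoly_zero hs⟩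
    by_cases hS : V.GrSimple
    · exact ⟨{V}, by simpa using hS, by simp, by simp⟩
    have : ∃ p : AddSubgroup V.carrier, V.IsGrSub p ∧ p ≠ ⊥ ∧ p ≠ ⊤ := by
      by_contra hc
      push Not at hc
      refine hS ⟨hn, fun p hp => ?_⟩
      by_contra hh
      push Not at hh
      exact hh.2 (hc p hp hh.1)
    obtain ⟨p, ⟨⟨-, hp1⟩, hp2⟩, hb, ht⟩ := this
    let P : Submodule H V.carrier := { p with smul_mem' := fun h x hx => hp1 h x hx }
    have s := bnSES V P hp2
    have hd := bn_finrank_ses s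
    have hX : 0 < Module.finrank R (bnSub V P hp2).carrier := by
      have : Nontrivial P := by
        rw [Submodule.nontrivial_iff_ne_bot]
        intro h
        exact hb (congrArg Submodule.toAddSubgroup h)
      have : Nontrivial (bnSub V P hp2).carrier := this
      exact Module.finrank_pos
    have hZ : 0 < Module.finrank R (bnQuot V P hp2).carrier := by
      have : Nontrivial (V.carrier ⧸ P) := by
        rw [Submodule.Quotient.nontrivial_iff]
        intro h
        exact ht (congrArg Submodule.toAddSubgroup h)
      have : Nontrivial (bnQuot V P hp2).carrier := this
      exact Module.finrank_pos
    obtain ⟨L1, a1, b1, c1⟩ := ih _ (by omega) (bnSub V P hp2) rfl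
    obtain ⟨L2, a2, b2, c2⟩ := ih _ (by omega) (bnQuot V P hp2) rfl
    refine ⟨L1 + L2, ?_, ?_, ?_⟩
    · intro M hM
      rcases Multiset.mem_add.1 hM with h | h
      exacts [a1 M h, a2 M h]
    · rw [bn_cls_ses s, b1, b2, Multiset.map_add, Multiset.sum_add]
    · intro h i
      rw [bn_cpoly_ses s, c1, c2, Multiset.map_add, Multiset.prod_add]

section BNZero

variable [GradedAlgebra 𝒜]

/-- The degree-`0` subalgebra acts on each graded piece. -/
noncomputable instance bnMod (V : GrMod R H 𝒜 R) (i : ℤ) : Module (𝒜 0) (V.grading i) where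
  smul h x := V.degAct h i x
  one_smul x := Subtype.ext (one_smul H (x : V.carrier))
  mul_smul a b x := Subtype.ext (mul_smul (a : H) (b : H) (x : V.carrier))
  smul_zero a := map_zero _
  smul_add a := map_add _
  add_smul a b x := Subtype.ext (add_smul (a : H) (b : H) (x : V.carrier))
  zero_smul x := Subtype.ext (zero_smul H (x : V.carrier))

lemma bnMod_coe (V : GrMod R H 𝒜 R) (i : ℤ) (h : 𝒜 0) (x : V.grading i) :
    ((h • x : V.grading i) : V.carrier) = (h : H) • (x : V.carrier) := rfl

instance bnModComm (V : GrMod R H 𝒜 R) (i : ℤ) : SMulCommClass (𝒜 0) R (V.grading i) where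
  smul_comm h a x := Subtype.ext (V.smul_comm' h a x)

/-- A nonzero homogeneous element generates a graded simple module. -/
lemma bn_gen {M : GrMod R H 𝒜 R} (hM : M.GrSimple) {i : ℤ} {x : M.carrier}
    (hx : x ∈ M.grading i) (h0 : x ≠ 0) (y : M.carrier) : ∃ h : H, h • x = y := by
  have := hM.2 (Submodule.span H {x}).toAddSubgroup ⟨⟨?_, ?_⟩, ?_⟩
  · rcases this with h | h
    · exact absurd (by
        have : x ∈ (Submodule.span H {x}).toAddSubgroup := Submodule.mem_span_singleton_self x
        rw [h] at this
        exact this) h0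
    · have : y ∈ (Submodule.span H {x}).toAddSubgroup := by rw [h]; trivial
      exact Submodule.mem_span_singleton.1 this
  · intro a z hz
    exact Submodule.smul_of_tower_mem (S := R) (Submodule.span H {x}) a hz
  · intro a z hz
    exact Submodule.smul_mem (Submodule.span H {x}) a hz
  · intro z hz k
    obtain ⟨h, rfl⟩ := Submodule.mem_span_singleton.1 hz
    exact Submodule.mem_span_singleton.2 ⟨_, (bnPr_smul M h hx k).symm⟩

lemma bn_simple {M : GrMod R H 𝒜 R} (hM : M.GrSimple) {i : ℤ} (hi : Nontrivial (M.grading i)) :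
    IsSimpleModule (𝒜 0) (M.grading i) := by
  rw [isSimpleModule_iff_toSpanSingleton_surjective]
  refine ⟨hi, fun x hx y => ?_⟩
  obtain ⟨h, hh⟩ := bn_gen hM x.2 (fun h => hx (Subtype.ext h)) (y : M.carrier)
  have h2 := bnPr_smul M h x.2 i
  rw [hh, bnPr_same M y.2] at h2
  rw [sub_self] at h2
  exact ⟨decompose 𝒜 h 0, Subtype.ext h2.symm⟩

lemma bn_ann {M N : GrMod R H 𝒜 R} (hN : N.GrSimple) {i : ℤ}
    (f : M.grading i →ₗ[𝒜 0] N.grading i) (x : M.grading i) (h : H)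
    (hx : h • (x : M.carrier) = 0) : h • (f x : N.carrier) = 0 := by
  by_cases hf : (f x : N.carrier) = 0
  · rw [hf, smul_zero]
  apply bn_eq_zero N
  intro k
  have hk := bnPr_smul M h x.2 k
  rw [hx, map_zero] at hk
  rw [bnPr_smul N h (f x).2 k]
  set a := decompose 𝒜 h (k - i)
  by_contra hne
  have hmem := N.grading_smul _ _ a a.2 _ (f x).2
  obtain ⟨g, hg⟩ := bn_gen hN hmem hne (f x : N.carrier)
  have h2 := bnPr_smul N g hmem i
  rw [hg, bnPr_same N (f x).2] at h2
  set b := decompose 𝒜 g (i - (k - i + i))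
  have hc : (b : H) * a ∈ 𝒜 0 := by
    have := SetLike.mul_mem_graded b.2 a.2
    rwa [show i - (k - i + i) + (k - i) = 0 by ring] at this
  have h3 : f ((⟨_, hc⟩ : 𝒜 0) • x) = (⟨_, hc⟩ : 𝒜 0) • f x := map_smul f _ _
  have h4 : (⟨_, hc⟩ : 𝒜 0) • x = 0 := by
    apply Subtype.ext
    rw [bnMod_coe, mul_smul, ← hk, smul_zero]
    rfl
  rw [h4, map_zero] at h3
  have h5 := congrArg Subtype.val h3
  rw [bnMod_coe, mul_smul, ← h2] at h5
  exact hf h5.symm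

lemma bn_isoOf {M N : GrMod R H 𝒜 R} (hM : M.GrSimple) (hN : N.GrSimple) {i : ℤ}
    (hi : Nontrivial (M.grading i))
    (f : M.grading i →ₗ[𝒜 0] N.grading i) (hf : Bijective f) : M.GrIso N := by
  obtain ⟨x, hx⟩ := exists_ne (0 : M.grading i)
  have hx' : (x : M.carrier) ≠ 0 := fun h => hx (Subtype.ext h)
  have hfx : (f x : N.carrier) ≠ 0 := fun h =>
    hx (hf.1 ((Subtype.ext h : f x = 0).trans (map_zero f).symm))
  have hann : ∀ h : H, h • (x : M.carrier) = 0 ↔ h • (f x : N.carrier) = 0 := by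
    intro h
    refine ⟨bn_ann hN f x h, fun hh => ?_⟩
    let e := LinearEquiv.ofBijective f hf
    have := bn_ann hM e.symm.toLinearMap (f x) h hh
    have h2 : e.symm.toLinearMap (f x) = x := e.symm_apply_apply x
    rwa [h2] at this
  have hann2 : ∀ h h' : H, h • (x : M.carrier) = h' • (x : M.carrier) ↔
      h • (f x : N.carrier) = h' • (f x : N.carrier) := by
    intro h h'
    rw [← sub_eq_zero, ← sub_smul, hann, sub_smul, sub_eq_zero]
  choose u hu using bn_gen hM x.2 hx'
  choose v hv using bn_gen hN (f x).2 hfx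
  have key : ∀ h : H, u (h • (x : M.carrier)) • (f x : N.carrier) = h • (f x : N.carrier) :=
    fun h => (hann2 _ _).1 (hu _)
  let e : M.carrier ≃+ N.carrier :=
    { toFun := fun m => u m • (f x : N.carrier)
      invFun := fun n => v n • (x : M.carrier)
      left_inv := fun m => by
        refine Eq.trans ?_ (hu m)
        exact (hann2 _ _).2 (hv _)
      right_inv := fun n => by
        refine Eq.trans ?_ (hv n)
        exact key _
      map_add' := fun m m' => by
        rw [← add_smul]
        refine (hann2 _ _).1 ?_
        rw [hu, add_smul, hu, hu] }
  have he : ∀ (h : H) (m : M.carrier), e (h • m) = h • e m := by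
    intro h m
    change u (h • m) • (f x : N.carrier) = h • u m • (f x : N.carrier)
    rw [← mul_smul]
    refine (hann2 _ _).1 ?_
    rw [hu, mul_smul, hu]
  refine ⟨e, ?_, he, ?_⟩
  · intro a m
    rw [← algebraMap_smul H a m, he, algebraMap_smul]
  · intro k m hm
    have h1 := bnPr_smul M (u m) x.2 k
    rw [hu, bnPr_same M hm] at h1
    have h2 : e m = ((decompose 𝒜 (u m) (k - i) : 𝒜 (k - i)) : H) • (f x : N.carrier) :=
      (hann2 _ _).1 ((hu m).trans h1)
    rw [h2]
    have := N.grading_smul _ _ _ (decompose 𝒜 (u m) (k - i)).2 _ (f x).2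
    rwa [sub_add_cancel] at this

lemma bn_sep_one {M N : GrMod R H 𝒜 R} (hM : M.GrSimple) (hN : N.GrSimple) {i : ℤ}
    (hi : Nontrivial (M.grading i)) (hno : ¬ M.GrIso N) :
    ∃ a : 𝒜 0, (∀ m : M.grading i, a • m = m) ∧ ∀ n : N.grading i, a • n = 0 := by
  rcases subsingleton_or_nontrivial (N.grading i) with hs | hn
  · exact ⟨1, fun m => one_smul _ m, fun n => Subsingleton.elim _ _⟩
  have := bn_simple hM hi
  have := bn_simple hN hn
  exact bn_sep (K := R) fun f hf => hno (bn_isoOf hM hN hi f hf)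

lemma bn_sep_all {M : GrMod R H 𝒜 R} (hM : M.GrSimple) {i : ℤ}
    (hi : Nontrivial (M.grading i)) (L : Multiset (GrMod R H 𝒜 R)) :
    (∀ N ∈ L, N.GrSimple ∧ ¬ M.GrIso N) →
    ∃ a : 𝒜 0, (∀ m : M.grading i, a • m = m) ∧ ∀ N ∈ L, ∀ n : N.grading i, a • n = 0 := by
  induction L using Multiset.induction_on with
  | empty => exact fun _ => ⟨1, fun m => one_smul _ m, by simp⟩
  | cons N L ih =>
    intro h
    obtain ⟨a, ha, ha'⟩ := ih fun N hN => h N (Multiset.mem_cons_of_mem hN)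
    obtain ⟨hN1, hN2⟩ := h N (Multiset.mem_cons_self N L)
    obtain ⟨b, hb, hb'⟩ := bn_sep_one hM hN1 hi hN2
    refine ⟨a * b, fun m => by rw [mul_smul, hb, ha], fun K hK n => ?_⟩
    rcases Multiset.mem_cons.1 hK with rfl | hK
    · rw [mul_smul, hb', smul_zero]
    · rw [mul_smul, ha' K hK]

lemma bn_nontrivial {M : GrMod R H 𝒜 R} (hM : M.GrSimple) : ∃ i, Nontrivial (M.grading i) := by
  by_contra hc
  push Not at hc
  obtain ⟨x, hx⟩ := @exists_ne _ hM.1 (0 : M.carrier)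
  refine hx (bn_eq_zero M x fun i => ?_)
  have := hc i
  exact congrArg Subtype.val (Subsingleton.elim (⟨_, bnPr_mem M i x⟩ : M.grading i) 0)

lemma bn_exists_iso {M : GrMod R H 𝒜 R} (hM : M.GrSimple) (L L' : Multiset (GrMod R H 𝒜 R))
    (hL' : ∀ N ∈ L', N.GrSimple)
    (h : ∀ h i, ((M ::ₘ L).map fun M => M.cpoly h i).prod = (L'.map fun M => M.cpoly h i).prod) :
    ∃ N ∈ L', M.GrIso N := by
  by_contra hc
  push Not at hc
  obtain ⟨i, hi⟩ := bn_nontrivial hM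
  obtain ⟨a, ha, ha'⟩ := bn_sep_all hM hi L' fun N hN => ⟨hL' N hN, hc N hN⟩
  have h1 := congrArg (Polynomial.eval 1) (h a i)
  have hMp : M.cpoly a i = (Polynomial.X - 1) ^ Module.finrank R (M.grading i) := by
    have : M.degAct a i = 1 := LinearMap.ext ha
    rw [GrMod.cpoly, this, LinearMap.charpoly_one]
  have hpos : 0 < Module.finrank R (M.grading i) := Module.finrank_pos
  rw [Multiset.map_cons, Multiset.prod_cons, hMp, Polynomial.eval_mul, Polynomial.eval_pow,
    Polynomial.eval_sub, Polynomial.eval_X, Polynomial.eval_one, sub_self,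
    zero_pow hpos.ne', zero_mul, Polynomial.eval_multiset_prod, Multiset.map_map] at h1
  refine zero_ne_one (h1.trans (Multiset.prod_eq_one ?_))
  intro c hcm
  obtain ⟨N, hN, rfl⟩ := Multiset.mem_map.1 hcm
  have : N.degAct a i = 0 := LinearMap.ext (ha' N hN)
  simp [GrMod.cpoly, this, LinearMap.charpoly_zero]

lemma bn_multiset (L : Multiset (GrMod R H 𝒜 R)) : ∀ L' : Multiset (GrMod R H 𝒜 R),
    (∀ M ∈ L, M.GrSimple) → (∀ M ∈ L', M.GrSimple) →
    (∀ h i, (L.map fun M => M.cpoly h i).prod = (L'.map fun M => M.cpoly h i).prod) →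
    (L.map GrMod.cls).sum = (L'.map GrMod.cls).sum := by
  induction L using Multiset.induction_on with
  | empty =>
    intro L' _ hL' h
    rcases L'.empty_or_exists_mem with rfl | ⟨N, hN⟩
    · rfl
    · obtain ⟨K, rfl⟩ := Multiset.exists_cons_of_mem hN
      obtain ⟨_, hx, _⟩ := bn_exists_iso (hL' N hN) K 0 (by simp) fun a i => (h a i).symm
      simp at hx
  | cons M L ih =>
    intro L' hL hL' h
    obtain ⟨N, hN, hiso⟩ := bn_exists_iso (hL M (Multiset.mem_cons_self M L)) L L' hL' h
    obtain ⟨K, rfl⟩ := Multiset.exists_cons_of_mem hN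
    obtain ⟨h1, h2⟩ := bn_iso hiso
    rw [Multiset.map_cons, Multiset.map_cons, Multiset.sum_cons, Multiset.sum_cons, h1]
    congr 1
    refine ih K (fun M hM => hL M (Multiset.mem_cons_of_mem hM))
      (fun M hM => hL' M (Multiset.mem_cons_of_mem hM)) fun a i => ?_
    have h3 := h a i
    rw [Multiset.map_cons, Multiset.map_cons, Multiset.prod_cons, Multiset.prod_cons, h2] at h3
    exact mul_left_cancel₀ (LinearMap.charpoly_monic (N.degAct a i)).ne_zero h3

end BNZero

end BNGraded

/-- graded Brauer–Nesbitt. If the irreducible graded characters of `H` are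
linearly independent and two finite-dimensional graded `H`-modules `V`, `W` have, for every
`h₀ ∈ H_0` and every `i ∈ ℤ`, the same characteristic polynomial of `ρ_{V_i}(h₀)` and
`ρ_{W_i}(h₀)`, then `[V] = [W]` in the Grothendieck group of finite-dimensional graded
`H`-modules; equivalently, the map `p_R` is injective on `R_0^+(H)`. -/
theorem graded_brauer_nesbitt
    (R : Type u) [Field R] (H : Type u) [Ring H] [Algebra R H] [Module.Finite R H]
    (𝒜 : ℤ → Submodule R H) [GradedAlgebra 𝒜]
    (hIrr : LinearIndependent R
      (Subtype.val : IrrGrChars R H 𝒜 R → (H → LaurentPolynomial R)))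
    (V W : GrMod R H 𝒜 R)
    (hpol : ∀ (h : 𝒜 0) (i : ℤ), V.cpoly h i = W.cpoly h i) :
    V.cls = W.cls := by
  obtain ⟨L, hL1, hL2, hL3⟩ := bn_filtration _ V rfl
  obtain ⟨L', hL1', hL2', hL3'⟩ := bn_filtration _ W rfl
  rw [hL2, hL2']
  exact bn_multiset L L' hL1 hL1' fun h i => by rw [← hL3, ← hL3', hpol]
end

section
/- Let A be an integral domain, integrally closed in its field of fractions K, let H be a Z-graded associative A-algebra, finitely generated and free over A, and let θ : A → L be a ring homomorphism into a field L such that L is the field of fractions of θ(A). Let O ⊆ K be a valuation ring with maximal ideal J(O) such that A ⊆ O and J(O) ∩ A = Ker(θ), with residue field k (so L embeds in k via θ); assume LH is split, or L = k and L is perfect. If Ṽ and W̃ are graded OH-lattices such that the graded KH-modules K ⊗_O Ṽ and K ⊗_O W̃ have the same class in the graded Grothendieck group of KH (the same graded composition factors with multiplicities), then the modular reductions k ⊗_O Ṽ and k ⊗_O W̃ have the same class in the graded Grothendieck group of kH. Hence modular reduction induces a well-defined graded decomposition map d^gr_θ : R_0^+(KH) → R_0^+(LH) with d^gr_θ([K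 ⊗_O Ṽ]) = [k ⊗_O Ṽ], and this map commutes with the grading shifts, i.e., it is a homomorphism of N[q,q^{-1}]-semigroups. -/
universe u

open DirectSum Function

section LinAlg

variable {K : Type u} [Field K] {O : ValuationSubring K}
  {V : Type u} [AddCommGroup V] [Module K V]

theorem mI_val (c : O) : c ∈ IsLocalRing.maximalIdeal O ↔ O.valuation (c : K) < 1 :=
  O.valuation_lt_one_iff c

theorem mem_mI {P : Submodule O V} {x : V} :
    x ∈ IsLocalRing.maximalIdeal O • P ↔
      ∃ c ∈ IsLocalRing.maximalIdeal O, ∃ y ∈ P, x = c • y := by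
  constructor
  · intro hx
    refine Submodule.smul_induction_on hx ?_ ?_
    · intro c hc y hy
      exact ⟨c, hc, y, hy, rfl⟩
    · rintro _ _ ⟨c, hc, y, hy, rfl⟩ ⟨c', hc', y', hy', rfl⟩
      rcases ValuationRing.dvd_total c c' with ⟨d, rfl⟩ | ⟨d, rfl⟩
      · exact ⟨c, hc, y + d • y', P.add_mem hy (P.smul_mem _ hy'), by
          rw [smul_add, mul_smul]⟩
      · exact ⟨c', hc', d • y + y', P.add_mem (P.smul_mem _ hy) hy', by
          rw [smul_add, mul_smul]⟩
  · rintro ⟨c, hc, y, hy, rfl⟩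
    exact Submodule.smul_mem_smul hc hy

theorem free_of_fg (L : Submodule O V) (hfg : L.FG) : Module.Free O L := by
  have : Module.Finite O L := Module.Finite.iff_fg.2 hfg
  have : Module.Flat O L := by
    rw [Module.Flat.flat_iff_torsion_eq_bot_of_isBezout]
    rw [Submodule.eq_bot_iff]
    rintro x ⟨a, ha⟩
    have h1 : ((a : O) : K) • (x : V) = 0 := by
      exact congrArg Subtype.val ha
    have ha0 : ((a : O) : K) ≠ 0 := by
      simp
    apply Subtype.ext
    exact (smul_eq_zero.1 h1).resolve_left ha0
  exact Module.free_of_flat_of_isLocalRing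

theorem fg_basis (L : Submodule O V) (hfg : L.FG)
    (hs : Submodule.span K (L : Set V) = ⊤) :
    ∃ (n : ℕ) (b : Module.Basis (Fin n) K V),
      ∀ x, x ∈ L ↔ ∀ i, b.repr x i ∈ O := by
  have := free_of_fg L hfg
  have : Module.Finite O L := Module.Finite.iff_fg.2 hfg
  let b0 := Module.finBasis O L
  have hli : LinearIndependent K (fun i => (b0 i : V)) := by
    have h1 : LinearIndependent O (fun i => (b0 i : V)) :=
      b0.linearIndependent.map' L.subtype (by simp)
    exact (LinearIndependent.iff_fractionRing O K).1 h1
  have hsp : ⊤ ≤ Submodule.span K (Set.range (fun i => (b0 i : V))) := by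
    rw [← hs, Submodule.span_le]
    intro x hx
    have := b0.sum_repr ⟨x, hx⟩
    have h2 : _ = x := congrArg Subtype.val this
    rw [← h2]
    simp only [AddSubmonoidClass.coe_finsetSum, Submodule.coe_smul]
    refine Submodule.sum_mem _ fun i _ => ?_
    exact Submodule.smul_mem _ ((b0.repr ⟨x, hx⟩ i : O) : K)
      (Submodule.subset_span ⟨i, rfl⟩)
  refine ⟨_, Module.Basis.mk hli hsp, fun x => ⟨fun hx i => ?_, fun hx => ?_⟩⟩
  · have := b0.sum_repr ⟨x, hx⟩
    have h2 := congrArg Subtype.val this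
    simp only [AddSubmonoidClass.coe_finsetSum, Submodule.coe_smul] at h2
    have h3 : x = ∑ j, ((b0.repr ⟨x, hx⟩ j : O) : K) • (Module.Basis.mk hli hsp) j := by
      refine h2.symm.trans (Finset.sum_congr rfl fun j _ => ?_)
      rw [Module.Basis.mk_apply]
      rfl
    have h4 : (Module.Basis.mk hli hsp).repr x i = ((b0.repr ⟨x, hx⟩ i : O) : K) := by
      conv_lhs => rw [h3]
      rw [Module.Basis.repr_sum_self]
    rw [h4]
    exact (b0.repr ⟨x, hx⟩ i).2
  · rw [← (Module.Basis.mk hli hsp).sum_repr x]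
    refine Submodule.sum_mem _ fun i _ => ?_
    rw [Module.Basis.mk_apply]
    exact L.smul_mem ⟨_, hx i⟩ (b0 i).2

theorem simul (n : ℕ) : ∀ (V : Type u) [AddCommGroup V] [Module K V] [FiniteDimensional K V],
    Module.finrank K V = n → ∀ L L' : Submodule O V, L.FG → L'.FG →
    Submodule.span K (L : Set V) = ⊤ → Submodule.span K (L' : Set V) = ⊤ →
    ∃ (E : V ≃ₗ[K] (Fin n → K)) (a : Fin n → K), (∀ i, a i ≠ 0) ∧
      (∀ x, x ∈ L ↔ ∀ i, O.valuation (E x i) ≤ 1) ∧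
      (∀ x, x ∈ L' ↔ ∀ i, O.valuation (E x i) ≤ O.valuation (a i)) := by
  induction n with
  | zero =>
    intro V _ _ _ hn L L' _ _ _ _
    have : Subsingleton V := Module.finrank_zero_iff.1 hn
    refine ⟨LinearEquiv.ofFinrankEq _ _ (by simp [hn]), fun _ => 1, by simp, ?_, ?_⟩
    · intro x
      rw [Subsingleton.elim x 0]
      simp
    · intro x
      rw [Subsingleton.elim x 0]
      simp
  | succ n ih =>
    intro V _ _ _ hn L L' hL hL' hs hs'
    obtain ⟨m, b, hb⟩ := fg_basis L hL hs
    obtain ⟨s, hsL'⟩ := hL'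
    have hsne : (Finset.univ ×ˢ s : Finset (Fin m × V)).Nonempty := by
      by_contra hne
      rw [Finset.not_nonempty_iff_eq_empty, Finset.product_eq_empty] at hne
      have : Nontrivial V := Module.nontrivial_of_finrank_pos (R := K) (by omega)
      rcases hne with h | h
      · have : IsEmpty (Fin m) := Finset.univ_eq_empty_iff.1 h
        have := b.index_nonempty
        exact this.elim (fun i => IsEmpty.false i)
      · rw [h] at hsL'
        have : L' = ⊥ := by simpa using hsL'.symm
        rw [this] at hs'
        have h5 : (⊤ : Submodule K V) = ⊥ := by rw [← hs']; simp
        exact top_ne_bot h5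
    obtain ⟨⟨i0, y⟩, hy0, hmax⟩ :=
      Finset.exists_max_image _ (fun p : Fin m × V => O.valuation (b.repr p.2 p.1)) hsne
    simp only [Finset.mem_product, Finset.mem_univ, true_and, Prod.forall] at hy0 hmax
    have hmax' : ∀ i, ∀ x ∈ L', O.valuation (b.repr x i) ≤ O.valuation (b.repr y i0) := by
      intro i x hx
      rw [← hsL'] at hx
      induction hx using Submodule.span_induction with
      | mem x hx => exact hmax i x hx
      | zero => simp
      | add x z _ _ h1 h2 =>
        rw [map_add, Finsupp.add_apply]
        exact (O.valuation.map_add _ _).trans (max_le h1 h2)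
      | smul c x _ h =>
        have : b.repr (c • x) i = (c : K) * b.repr x i := by
          change b.repr ((c : K) • x) i = _
          simp
        rw [this, map_mul]
        exact (mul_le_of_le_one_left' (O.valuation_le_one c)).trans h
    set c := b.repr y i0 with hc
    have hyL' : y ∈ L' := by
      rw [← hsL']
      exact Submodule.subset_span hy0
    have hc0 : c ≠ 0 := by
      intro h0
      have : Nontrivial V := Module.nontrivial_of_finrank_pos (R := K) (by omega)
      have hz : ∀ x ∈ L', x = 0 := by
        intro x hx
        apply b.repr.injective
        ext i
        have := hmax' i x hx
        rw [h0] at this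
        simpa using this
      have : L' = ⊥ := (Submodule.eq_bot_iff _).2 hz
      rw [this] at hs'
      have h5 : (⊤ : Submodule K V) = ⊥ := by rw [← hs']; simp
      exact top_ne_bot h5
    have hvc : O.valuation c ≠ 0 := by simpa using hc0
    let lam : V →ₗ[K] K := b.coord i0
    have hlam : ∀ x, lam x = b.repr x i0 := fun x => rfl
    let e1 : V := c⁻¹ • y
    have hlame : lam e1 = 1 := by
      rw [hlam]
      simp [e1, ← hc, hc0]
    have he1 : e1 ∈ L := by
      rw [hb]
      intro i
      rw [← O.valuation_le_one_iff]
      simp only [e1, map_smul, Finsupp.smul_apply, smul_eq_mul, map_mul, map_inv₀]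
      have := hmax' i y hyL'
      calc _ ≤ (O.valuation c)⁻¹ * O.valuation c := by gcongr
        _ = 1 := inv_mul_cancel₀ hvc
    have hyc : y = c • e1 := by simp [e1, smul_smul, hc0]
    let W := LinearMap.ker lam
    have hp : ∀ x, x - lam x • e1 ∈ W := by
      intro x
      rw [LinearMap.mem_ker]
      simp [hlame]
    let p : V →ₗ[K] W :=
      (LinearMap.id - lam.smulRight e1).codRestrict W (fun x => by simpa using hp x)
    have hpv : ∀ x, ((p x : W) : V) = x - lam x • e1 := fun x => by simp [p]
    have hpW : ∀ w : W, p (w : V) = w := by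
      intro w
      apply Subtype.ext
      rw [hpv]
      have : lam (w : V) = 0 := w.2
      rw [this]; simp
    have hpe : ∀ t : K, p (t • e1) = 0 := by
      intro t
      apply Subtype.ext
      rw [hpv]
      simp [hlame]
    have hsurj : Function.Surjective p := fun w => ⟨w, hpW w⟩
    let pO : V →ₗ[O] W := p.restrictScalars O
    have hspan : ∀ M : Submodule O V, Submodule.span K (M : Set V) = ⊤ →
        Submodule.span K ((M.map pO : Submodule O W) : Set W) = ⊤ := by
      intro M hM
      have : ((M.map pO : Submodule O W) : Set W) = Set.image p (M : Set V) := by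
        ext; simp [pO]
      rw [this, ← Submodule.map_span, hM, Submodule.map_top, LinearMap.range_eq_top.2 hsurj]
    have hfr : Module.finrank K W = n := by
      have h1 := LinearMap.finrank_range_add_finrank_ker lam
      have h2 : LinearMap.range lam = ⊤ := by
        rw [LinearMap.range_eq_top]
        intro t
        exact ⟨t • e1, by simp [hlame]⟩
      rw [h2, finrank_top, Module.finrank_self] at h1
      change 1 + Module.finrank K W = _ at h1
      omega
    obtain ⟨E', a', ha', hE1, hE2⟩ := ih W hfr (L.map pO) (L'.map pO) (hL.map _)
      (Submodule.FG.map _ ⟨s, hsL'⟩) (hspan L hs) (hspan L' hs')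
    let E0 : V →ₗ[K] (Fin (n + 1) → K) :=
      LinearMap.pi (Fin.cons lam (fun i => (LinearMap.proj i).comp (E'.toLinearMap.comp p)))
    have hE00 : ∀ x, E0 x 0 = lam x := fun x => by simp [E0]
    have hE0s : ∀ x i, E0 x (Fin.succ i) = E' (p x) i := fun x i => by simp [E0]
    have hinj : Function.Injective E0 := by
      rw [← LinearMap.ker_eq_bot, LinearMap.ker_eq_bot']
      intro x hx
      have h1 : lam x = 0 := by rw [← hE00, hx]; rfl
      have h2 : p x = 0 := by
        apply E'.injective
        ext i
        rw [← hE0s, hx]; simp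
      have h3 := hpv x
      rw [h2, h1] at h3
      simpa using h3.symm
    let E : V ≃ₗ[K] (Fin (n + 1) → K) :=
      LinearEquiv.ofInjectiveOfFinrankEq E0 hinj (by simp [hn])
    have hE : ∀ x, E x = E0 x := fun x => rfl
    refine ⟨E, Fin.cons c a', ?_, ?_, ?_⟩
    · intro i
      refine Fin.cases ?_ (fun i => ?_) i
      · simpa using hc0
      · simpa using ha' i
    · intro x
      simp only [hE, Fin.forall_fin_succ, hE00, hE0s]
      rw [← hE1]
      constructor
      · intro hx
        exact ⟨by rw [hlam, O.valuation_le_one_iff]; exact (hb x).1 hx i0, ⟨x, hx, rfl⟩⟩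
      · rintro ⟨h1, z, hz, hzx⟩
        have h2 : z - lam z • e1 = x - lam x • e1 := by
          rw [← hpv, ← hpv]; exact congrArg Subtype.val hzx
        have h3 : x = z - lam z • e1 + lam x • e1 := by rw [h2]; abel
        rw [h3]
        refine L.add_mem (L.sub_mem hz ?_) ?_
        · exact L.smul_mem ⟨lam z, (hb z).1 hz i0⟩ he1
        · exact L.smul_mem ⟨lam x, (O.valuation_le_one_iff _).1 h1⟩ he1
    · intro x
      simp only [hE, Fin.forall_fin_succ, hE00, hE0s, Fin.cons_zero, Fin.cons_succ]
      rw [← hE2]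
      have key : ∀ t : K, O.valuation t ≤ O.valuation c → t • e1 ∈ L' := by
        intro t ht
        have h1 : t • e1 = (t * c⁻¹) • y := by simp [e1, smul_smul]
        rw [h1]
        refine L'.smul_mem ⟨t * c⁻¹, (O.valuation_le_one_iff _).1 ?_⟩ hyL'
        rw [map_mul, map_inv₀]
        calc _ ≤ O.valuation c * (O.valuation c)⁻¹ := by gcongr
          _ = 1 := mul_inv_cancel₀ hvc
      constructor
      · intro hx
        exact ⟨hmax' i0 x hx, ⟨x, hx, rfl⟩⟩
      · rintro ⟨h1, z, hz, hzx⟩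
        have h2 : z - lam z • e1 = x - lam x • e1 := by
          rw [← hpv, ← hpv]; exact congrArg Subtype.val hzx
        have h3 : x = z - lam z • e1 + lam x • e1 := by rw [h2]; abel
        rw [h3]
        exact L'.add_mem (L'.sub_mem hz (key _ (hmax' i0 z hz))) (key _ h1)

end LinAlg


section Boxes

variable {K : Type u} [Field K] {O : ValuationSubring K}
  {V : Type u} [AddCommGroup V] [Module K V] {n : ℕ}

theorem box_m (E : V ≃ₗ[K] (Fin n → K)) (D : Fin n → K) (hD : ∀ i, D i ≠ 0)
    (P : Submodule O V) (hP : ∀ x, x ∈ P ↔ ∀ i, O.valuation (E x i) ≤ O.valuation (D i)) (x : V) :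
    x ∈ IsLocalRing.maximalIdeal O • P ↔ ∀ i, O.valuation (E x i) < O.valuation (D i) := by
  constructor
  · intro hx i
    obtain ⟨c, hc, y, hy, rfl⟩ := mem_mI.1 hx
    have h1 : E (c • y) i = (c : K) * E y i := by
      change E ((c : K) • y) i = _
      simp
    rw [h1, map_mul]
    have h2 := (hP y).1 hy i
    have h3 := (mI_val c).1 hc
    have h4 : 0 < O.valuation (D i) := by
      rw [zero_lt_iff]; simpa using hD i
    calc _ ≤ O.valuation (c : K) * O.valuation (D i) := by gcongr
      _ < 1 * O.valuation (D i) := by gcongr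
      _ = _ := one_mul _
  · intro hx
    have h0 : x = ∑ i, E.symm (Pi.single i (E x i)) := by
      apply E.injective
      rw [map_sum]
      simp only [LinearEquiv.apply_symm_apply]
      rw [Finset.univ_sum_single]
    rw [h0]
    refine Submodule.sum_mem _ fun i _ => ?_
    have hDi : O.valuation (D i) ≠ 0 := by simpa using hD i
    have hlt : O.valuation (E x i / D i) < 1 := by
      rw [map_div₀]
      exact (div_lt_one₀ (zero_lt_iff.2 hDi)).2 (hx i)
    refine mem_mI.2 ⟨⟨E x i / D i, (O.valuation_le_one_iff _).1 hlt.le⟩, (mI_val _).2 hlt,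
      E.symm (Pi.single i (D i)), (hP _).2 fun j => ?_, ?_⟩
    · rw [LinearEquiv.apply_symm_apply]
      by_cases hj : j = i
      · subst hj; simp
      · simp [hj]
    · change _ = (E x i / D i) • E.symm (Pi.single i (D i))
      rw [← map_smul, ← Pi.single_smul, smul_eq_mul, div_mul_cancel₀ _ (hD i)]

theorem adj (E : V ≃ₗ[K] (Fin n → K)) (D D' : Fin n → K) (hD : ∀ i, D i ≠ 0)
    (hD' : ∀ i, D' i ≠ 0)
    (P P' : Submodule O V)
    (hP : ∀ x, x ∈ P ↔ ∀ i, O.valuation (E x i) ≤ O.valuation (D i))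
    (hP' : ∀ x, x ∈ P' ↔ ∀ i, O.valuation (E x i) ≤ O.valuation (D' i))
    (s : K) (hs0 : s ≠ 0) (hs : O.valuation s < 1)
    (hDD : ∀ i, O.valuation (D' i) = O.valuation (D i) ∨
      O.valuation (D' i) = O.valuation s * O.valuation (D i)) :
    P' ≤ P ∧ (∀ x ∈ P, s • x ∈ P') ∧
    (∀ x ∈ P, s • x ∈ IsLocalRing.maximalIdeal O • P' ↔
      x ∈ P' ⊔ IsLocalRing.maximalIdeal O • P) ∧
    (∀ y ∈ P', y ∈ P' ⊓ IsLocalRing.maximalIdeal O • P ↔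
      ∃ x ∈ P, y - s • x ∈ IsLocalRing.maximalIdeal O • P') := by
  classical
  have hvs : O.valuation s ≠ 0 := by simpa using hs0
  have hle : P' ≤ P := by
    intro x hx
    rw [hP]
    intro i
    refine ((hP' x).1 hx i).trans ?_
    rcases hDD i with h | h
    · rw [h]
    · rw [h]; exact mul_le_of_le_one_left' hs.le
  have hsP : ∀ x ∈ P, s • x ∈ P' := by
    intro x hx
    rw [hP']
    intro i
    have h1 := (hP x).1 hx i
    have h2 : O.valuation (E (s • x) i) = O.valuation s * O.valuation (E x i) := by simp
    rw [h2]
    rcases hDD i with h | h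
    · rw [h]; exact (mul_le_of_le_one_left' hs.le).trans h1
    · rw [h]; gcongr
  have hsm : (⟨s, (O.valuation_le_one_iff _).1 hs.le⟩ : O) ∈ IsLocalRing.maximalIdeal O :=
    (mI_val _).2 hs
  have hmm : IsLocalRing.maximalIdeal O • P' ≤ IsLocalRing.maximalIdeal O • P :=
    Submodule.smul_mono le_rfl hle
  refine ⟨hle, hsP, fun x hx => ⟨fun h => ?_, fun h => ?_⟩, fun y hy => ⟨fun h => ?_, ?_⟩⟩
  · rw [box_m E D' hD' P' hP'] at h
    let x1 : V := E.symm (fun i => if O.valuation (D' i) = O.valuation (D i) then E x i else 0)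
    have hx1 : ∀ i, E x1 i = if O.valuation (D' i) = O.valuation (D i) then E x i else 0 := by
      intro i; simp [x1]
    have hxx : x = x1 + (x - x1) := by abel
    rw [hxx]
    refine Submodule.add_mem_sup ?_ ?_
    · rw [hP']
      intro i
      rw [hx1]
      split_ifs with hi
      · rw [hi]; exact (hP x).1 hx i
      · simp
    · rw [box_m E D hD P hP]
      intro i
      rw [map_sub, Pi.sub_apply, hx1]
      split_ifs with hi
      · rw [sub_self, map_zero, zero_lt_iff]; simpa using hD i
      · rw [sub_zero]
        have h1 := h i
        rw [(hDD i).resolve_left hi] at h1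
        have h2 : O.valuation (E (s • x) i) = O.valuation s * O.valuation (E x i) := by simp
        rw [h2] at h1
        exact lt_of_mul_lt_mul_left' h1
  · obtain ⟨u, hu, w, hw, rfl⟩ := Submodule.mem_sup.1 h
    rw [smul_add]
    refine Submodule.add_mem _ (mem_mI.2 ⟨_, hsm, u, hu, rfl⟩) ?_
    obtain ⟨c, hc, z, hz, rfl⟩ := mem_mI.1 hw
    refine mem_mI.2 ⟨c, hc, s • z, hsP z hz, ?_⟩
    change s • (c : K) • z = (c : K) • s • z
    rw [smul_comm]
  · have h2 := (box_m E D hD P hP y).1 h.2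
    have h1 := (hP' y).1 h.1
    let y1 : V := E.symm (fun i => if O.valuation (D' i) = O.valuation (D i) then 0 else E y i)
    have hy1 : ∀ i, E y1 i = if O.valuation (D' i) = O.valuation (D i) then 0 else E y i := by
      intro i; simp [y1]
    refine ⟨s⁻¹ • y1, ?_, ?_⟩
    · rw [hP]
      intro i
      rw [map_smul, Pi.smul_apply, hy1]
      split_ifs with hi
      · simp
      · have h3 := h1 i
        rw [(hDD i).resolve_left hi] at h3
        rw [smul_eq_mul, map_mul, map_inv₀]
        calc _ ≤ (O.valuation s)⁻¹ * (O.valuation s * O.valuation (D i)) := by gcongr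
          _ = _ := by rw [← mul_assoc, inv_mul_cancel₀ hvs, one_mul]
    · rw [smul_smul, mul_inv_cancel₀ hs0, one_smul, box_m E D' hD' P' hP']
      intro i
      rw [map_sub, Pi.sub_apply, hy1]
      split_ifs with hi
      · rw [sub_zero, hi]; exact h2 i
      · rw [sub_self, map_zero, zero_lt_iff]; simpa using hD' i
  · rintro ⟨x, hx, hxy⟩
    refine ⟨hy, ?_⟩
    have : y = (y - s • x) + s • x := by abel
    rw [this]
    exact Submodule.add_mem _ (hmm hxy) (mem_mI.2 ⟨_, hsm, x, hx, rfl⟩)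

/-- Multiplication by a scalar of `K`, as an `O`-linear map. -/
def scl (O : ValuationSubring K) (V : Type u) [AddCommGroup V] [Module K V] (c : K) :
    V →ₗ[O] V :=
  (LinearMap.lsmul K V c).restrictScalars O

theorem scl_apply (c : K) (x : V) : scl O V c x = c • x := rfl

theorem box_sup (E : V ≃ₗ[K] (Fin n → K)) (a : Fin n → K) (L L' : Submodule O V)
    (hL : ∀ x, x ∈ L ↔ ∀ i, O.valuation (E x i) ≤ 1)
    (hL' : ∀ x, x ∈ L' ↔ ∀ i, O.valuation (E x i) ≤ O.valuation (a i))
    (c : K) (hc : c ≠ 0) (x : V) :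
    x ∈ L' ⊔ L.map (scl O V c) ↔
      ∀ i, O.valuation (E x i) ≤ max (O.valuation (a i)) (O.valuation c) := by
  classical
  have hvc : O.valuation c ≠ 0 := by simpa using hc
  constructor
  · intro h i
    obtain ⟨u, hu, _, ⟨w, hw, rfl⟩, rfl⟩ := Submodule.mem_sup.1 h
    rw [map_add, Pi.add_apply]
    refine (O.valuation.map_add _ _).trans (max_le_max ((hL' u).1 hu i) ?_)
    rw [scl_apply, map_smul, Pi.smul_apply, smul_eq_mul, map_mul]
    exact mul_le_of_le_one_right' ((hL w).1 hw i)
  · intro h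
    let x1 : V := E.symm (fun i => if O.valuation (E x i) ≤ O.valuation (a i) then E x i else 0)
    have hx1 : ∀ i, E x1 i = if O.valuation (E x i) ≤ O.valuation (a i) then E x i else 0 := by
      intro i; simp [x1]
    have hxx : x = x1 + (x - x1) := by abel
    rw [hxx]
    refine Submodule.add_mem_sup ?_ ⟨c⁻¹ • (x - x1), ?_, ?_⟩
    · rw [hL']
      intro i
      rw [hx1]
      split_ifs with hi
      · exact hi
      · simp
    · refine (hL _).2 fun i => ?_
      rw [map_smul, Pi.smul_apply, map_sub, Pi.sub_apply, hx1]
      split_ifs with hi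
      · simp
      · rw [sub_zero, smul_eq_mul, map_mul, map_inv₀]
        have h3 := (le_max_iff.1 (h i)).resolve_left hi
        calc _ ≤ (O.valuation c)⁻¹ * O.valuation c := by gcongr
          _ = 1 := inv_mul_cancel₀ hvc
    · rw [scl_apply, smul_smul, mul_inv_cancel₀ hc, one_smul]

end Boxes


section Red

variable {A : Type u} [CommRing A] {H : Type u} [Ring H] [Algebra A H]
  {𝒜 : ℤ → Submodule A H} {K : Type u} [Field K] [Algebra A K]
  {O : ValuationSubring K} {k : Type u} [Field k] [Algebra A k]

/-- `φ` exhibits `Y` as the subquotient `P / Q` of `V`. -/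
def Red (π : O →+* k) (V : GrMod A H 𝒜 K) (P Q : AddSubgroup V.carrier)
    (Y : GrMod A H 𝒜 k) (φ : P →+ Y.carrier) : Prop :=
  Surjective φ ∧
  (∀ x : P, φ x = 0 ↔ (x : V.carrier) ∈ Q) ∧
  (∀ (c : O) (x y : P), (y : V.carrier) = (c : K) • (x : V.carrier) → φ y = π c • φ x) ∧
  (∀ (h : H) (x y : P), (y : V.carrier) = h • (x : V.carrier) → φ y = h • φ x) ∧
  (∀ (i : ℤ) (x : P), (x : V.carrier) ∈ V.grading i → φ x ∈ Y.grading i) ∧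
  (∀ i : ℤ, ∀ y ∈ Y.grading i, ∃ x : P, (x : V.carrier) ∈ V.grading i ∧ φ x = y)

/-- Graded `H`-stable `O`-submodules. -/
structure GSub (V : GrMod A H 𝒜 K) (P : Submodule O V.carrier) : Prop where
  smulH : ∀ h : H, ∀ x ∈ P, h • x ∈ P
  gr : ∀ x ∈ P, ∀ i : ℤ,
    ((DirectSum.decompose V.grading x i : V.grading i) : V.carrier) ∈ P

/-- The action of `H` on a subquotient. -/
noncomputable def rhoX (V : GrMod A H 𝒜 K) (P Q : Submodule O V.carrier)
    (hP : ∀ h : H, ∀ x ∈ P, h • x ∈ P) (hQ : ∀ h : H, ∀ x ∈ Q, h • x ∈ Q) :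
    H →+* Module.End O (P ⧸ Q.comap P.subtype) where
  toFun h := Submodule.mapQ _ _
    ({ toFun := fun x => ⟨h • (x : V.carrier), hP h x x.2⟩
       map_add' := fun x y => Subtype.ext (smul_add h (x : V.carrier) y)
       map_smul' := fun c x => Subtype.ext (V.smul_comm' h (c : K) (x : V.carrier)) } :
      P →ₗ[O] P) (fun x hx => hQ h x hx)
  map_one' := by
    apply Submodule.linearMap_qext
    ext x
    change Submodule.Quotient.mk _ = Submodule.Quotient.mk _
    congr 1
    exact Subtype.ext (one_smul H (x : V.carrier))
  map_mul' a b := by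
    apply Submodule.linearMap_qext
    ext x
    change Submodule.Quotient.mk _ = Submodule.Quotient.mk _
    congr 1
    exact Subtype.ext (mul_smul a b (x : V.carrier))
  map_zero' := by
    apply Submodule.linearMap_qext
    ext x
    change Submodule.Quotient.mk _ = Submodule.Quotient.mk _
    congr 1
    exact Subtype.ext (zero_smul H (x : V.carrier))
  map_add' a b := by
    apply Submodule.linearMap_qext
    ext x
    change Submodule.Quotient.mk _ = Submodule.Quotient.mk _
    congr 1
    exact Subtype.ext (add_smul a b (x : V.carrier))

theorem rhoX_mk (V : GrMod A H 𝒜 K) (P Q : Submodule O V.carrier)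
    (hP : ∀ h : H, ∀ x ∈ P, h • x ∈ P) (hQ : ∀ h : H, ∀ x ∈ Q, h • x ∈ Q) (h : H) (x : P) :
    rhoX V P Q hP hQ h (Submodule.Quotient.mk x) =
      Submodule.Quotient.mk ⟨h • (x : V.carrier), hP h x x.2⟩ := rfl

theorem decomposition_of_proj {R M : Type u} [Ring R] [AddCommGroup M] [Module R M]
    (ℳ : ℤ → Submodule R M) (p : ℤ → M →+ M)
    (h1 : ∀ i, ∀ x ∈ ℳ i, p i x = x) (h2 : ∀ i j, i ≠ j → ∀ x ∈ ℳ j, p i x = 0)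
    (h3 : ∀ x, x ∈ ⨆ i, ℳ i) : DirectSum.IsInternal ℳ := by
  rw [DirectSum.isInternal_submodule_iff_iSupIndep_and_iSup_eq_top]
  refine ⟨?_, eq_top_iff.2 fun x _ => h3 x⟩
  intro i
  rw [Submodule.disjoint_def]
  intro x hx hx'
  rw [← h1 i x hx]
  rw [iSup_subtype'] at hx'
  clear hx
  induction hx' using Submodule.iSup_induction' with
  | mem j x hxj => exact h2 i j.1 (Ne.symm j.2) x hxj
  | zero => simp
  | add x y _ _ hx hy => rw [map_add, hx, hy, add_zero]

theorem exists_red (π : O →+* k) (hAO : ∀ a : A, algebraMap A K a ∈ O)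
    (hπsurj : Function.Surjective π)
    (hπker : ∀ o : O, π o = 0 ↔ ¬ IsUnit o)
    (hπA : ∀ a : A, π ⟨algebraMap A K a, hAO a⟩ = algebraMap A k a)
    (V : GrMod A H 𝒜 K) (P Q : Submodule O V.carrier) (hP : GSub V P) (hQ : GSub V Q)
    (hfg : P.FG) (hm : IsLocalRing.maximalIdeal O • P ≤ Q) :
    ∃ (Y : GrMod A H 𝒜 k) (φ : P.toAddSubgroup →+ Y.carrier),
      Red π V P.toAddSubgroup Q.toAddSubgroup Y φ := by
  classical
  let X := P ⧸ Q.comap P.subtype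
  have htor : Module.IsTorsionBySet O X (RingHom.ker π : Set O) := by
    rintro x ⟨c, hc⟩
    induction x using Submodule.Quotient.induction_on with
    | _ x =>
      change Submodule.Quotient.mk (c • x) = 0
      rw [Submodule.Quotient.mk_eq_zero]
      exact hm (Submodule.smul_mem_smul ((hπker c).1 hc) x.2)
  let m1 : Module (O ⧸ RingHom.ker π) X := htor.module
  let ek : k →+* (O ⧸ RingHom.ker π) :=
    (RingHom.quotientKerEquivOfSurjective hπsurj).symm.toRingHom
  let m2 : Module k X := Module.compHom X ek
  have hk : ∀ (c : O) (x : X), π c • x = c • x := by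
    intro c x
    change ek (π c) • x = _
    have : ek (π c) = Ideal.Quotient.mk _ c := by
      apply (RingHom.quotientKerEquivOfSurjective hπsurj).injective
      simp [ek]
    rw [this]
    exact htor.mk_smul c x
  let m3 : Module H X := Module.compHom X (rhoX V P Q hP.smulH hQ.smulH)
  have hH : ∀ (h : H) (x : P), h • (Submodule.Quotient.mk x : X) =
      Submodule.Quotient.mk ⟨h • (x : V.carrier), hP.smulH h x x.2⟩ := fun h x => rfl
  have hHr : ∀ (h : H) (x : X), h • x = rhoX V P Q hP.smulH hQ.smulH h x := fun h x => rfl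
  have hfin : Module.Finite k X := by
    have : Module.Finite O P := Module.Finite.iff_fg.2 hfg
    have : Module.Finite O X := inferInstance
    let : Algebra O k := π.toAlgebra
    have : IsScalarTower O k X := ⟨fun c s x => by
      obtain ⟨d, rfl⟩ := hπsurj s
      have : c • π d = π (c * d) := by rw [map_mul]; rfl
      rw [this, hk, hk, mul_smul]⟩
    exact Module.Finite.of_restrictScalars_finite O k X
  let gr : ℤ → Submodule k X := fun i =>
    { carrier := {x | ∃ y : P, (y : V.carrier) ∈ V.grading i ∧ Submodule.Quotient.mk y = x}
      add_mem' := by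
        rintro _ _ ⟨y, hy, rfl⟩ ⟨z, hz, rfl⟩
        exact ⟨y + z, (V.grading i).add_mem hy hz, rfl⟩
      zero_mem' := ⟨0, (V.grading i).zero_mem, rfl⟩
      smul_mem' := by
        rintro s _ ⟨y, hy, rfl⟩
        obtain ⟨c, rfl⟩ := hπsurj s
        rw [hk]
        exact ⟨c • y, (V.grading i).smul_mem (c : K) hy, rfl⟩ }
  have hgr : ∀ i x, x ∈ gr i ↔
    ∃ y : P, (y : V.carrier) ∈ V.grading i ∧ Submodule.Quotient.mk y = x := fun i x => Iff.rfl
  let pP : ℤ → P →ₗ[O] P := fun i =>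
    { toFun := fun x => ⟨(DirectSum.decompose V.grading (x : V.carrier) i : V.grading i),
        hP.gr x x.2 i⟩
      map_add' := fun x y => Subtype.ext (by simp [DirectSum.decompose_add])
      map_smul' := fun c x => Subtype.ext (by
        change ((DirectSum.decompose V.grading ((c : K) • (x : V.carrier)) i : V.grading i) :
          V.carrier) = (c : K) • _
        rw [DirectSum.decompose_smul]
        rfl) }
  let pX : ℤ → X →ₗ[O] X := fun i => Submodule.mapQ _ _ (pP i) (fun x hx => hQ.gr x hx i)
  have hpX : ∀ i (x : P), pX i (Submodule.Quotient.mk x) = Submodule.Quotient.mk (pP i x) :=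
    fun i x => rfl
  have hIntl : DirectSum.IsInternal gr := by
    refine decomposition_of_proj gr (fun i => (pX i).toAddMonoidHom) ?_ ?_ ?_
    · rintro i _ ⟨y, hy, rfl⟩
      rw [LinearMap.toAddMonoidHom_coe]
      rw [hpX]
      congr 1
      exact Subtype.ext (DirectSum.decompose_of_mem_same _ hy)
    · rintro i j hij _ ⟨y, hy, rfl⟩
      rw [LinearMap.toAddMonoidHom_coe]
      rw [hpX]
      have : pP i y = 0 := Subtype.ext (DirectSum.decompose_of_mem_ne _ hy hij.symm)
      rw [this]
      rfl
    · intro x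
      induction x using Submodule.Quotient.induction_on with
      | _ x =>
        have hx : x = ∑ i ∈ (DirectSum.decompose V.grading (x : V.carrier)).support, pP i x := by
          apply Subtype.ext
          rw [AddSubmonoidClass.coe_finsetSum]
          exact (DirectSum.sum_support_decompose V.grading (x : V.carrier)).symm
        have hx2 : (Submodule.Quotient.mk x : X) =
            ∑ i ∈ (DirectSum.decompose V.grading (x : V.carrier)).support,
              (Submodule.Quotient.mk (pP i x) : X) := by
          conv_lhs => rw [hx]
          exact map_sum (Submodule.mkQ _) _ _
        rw [hx2]
        refine Submodule.sum_mem _ fun i _ => Submodule.mem_iSup_of_mem i ?_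
        exact ⟨pP i x, SetLike.coe_mem _, rfl⟩
  let Y : GrMod A H 𝒜 k :=
    { carrier := X
      acg := inferInstance
      modS := m2
      modH := m3
      smul_comm' := by
        intro h s x
        obtain ⟨c, rfl⟩ := hπsurj s
        rw [hk, hk, hHr, hHr, map_smul]
      compat := by
        intro a x
        rw [← hπA, hk]
        induction x using Submodule.Quotient.induction_on with
        | _ x =>
          rw [hH]
          change _ = Submodule.Quotient.mk (_ • x)
          congr 1
          exact Subtype.ext (V.compat a x)
      fin := hfin
      grading := gr
      decomp := hIntl.chooseDecomposition
      grading_smul := by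
        rintro i j h hh _ ⟨y, hy, rfl⟩
        rw [hH]
        exact ⟨_, V.grading_smul i j h hh _ hy, rfl⟩ }
  refine ⟨Y, (show P →+ X from (Submodule.mkQ (Q.comap P.subtype)).toAddMonoidHom), ?_, ?_, ?_, ?_, ?_, ?_⟩
  · exact Submodule.mkQ_surjective (Q.comap P.subtype)
  · intro x
    exact Submodule.Quotient.mk_eq_zero _
  · intro c x y hxy
    refine Eq.trans ?_ (hk c _).symm
    change Submodule.Quotient.mk _ = Submodule.Quotient.mk _
    congr 1
    exact Subtype.ext hxy
  · intro h x y hxy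
    refine Eq.trans ?_ (hH h x).symm
    change Submodule.Quotient.mk _ = Submodule.Quotient.mk _
    congr 1
    exact Subtype.ext hxy
  · intro i x hx
    exact ⟨x, hx, rfl⟩
  · rintro i _ ⟨x, hx, rfl⟩
    exact ⟨x, hx, rfl⟩

end Red


section Maps

variable {A : Type u} [CommRing A] {H : Type u} [Ring H] [Algebra A H]
  {𝒜 : ℤ → Submodule A H} {K : Type u} [Field K] [Algebra A K]
  {O : ValuationSubring K} {k : Type u} [Field k] [Algebra A k]

/-- Degree-preserving homomorphisms of graded modules. -/
structure IsGrHom (V W : GrMod A H 𝒜 K) (f : V.carrier →ₗ[K] W.carrier) : Prop where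
  smulH : ∀ (h : H) (x : V.carrier), f (h • x) = h • f x
  gr : ∀ (i : ℤ), ∀ x ∈ V.grading i, f x ∈ W.grading i

theorem red_map (π : O →+* k) (hπsurj : Function.Surjective π)
    {V1 V2 : GrMod A H 𝒜 K} {P1 Q1 : AddSubgroup V1.carrier}
    {P2 Q2 : AddSubgroup V2.carrier} {Y1 Y2 : GrMod A H 𝒜 k} {φ1 : P1 →+ Y1.carrier}
    {φ2 : P2 →+ Y2.carrier} (hs1 : ∀ c : O, ∀ x ∈ P1, (c : K) • x ∈ P1)
    (hh1 : ∀ h : H, ∀ x ∈ P1, h • x ∈ P1)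
    (r1 : Red π V1 P1 Q1 Y1 φ1) (r2 : Red π V2 P2 Q2 Y2 φ2)
    (f : V1.carrier →ₗ[K] V2.carrier) (hf : IsGrHom V1 V2 f) (hP : ∀ x ∈ P1, f x ∈ P2)
    (hQ : ∀ x ∈ P1, x ∈ Q1 → f x ∈ Q2) :
    ∃ F : Y1.carrier →+ Y2.carrier, (∀ x : P1, F (φ1 x) = φ2 ⟨f x, hP x x.2⟩) ∧
      (∀ (s : k) (x : Y1.carrier), F (s • x) = s • F x) ∧
      (∀ (h : H) (x : Y1.carrier), F (h • x) = h • F x) ∧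
      (∀ (i : ℤ), ∀ x ∈ Y1.grading i, F x ∈ Y2.grading i) := by
  obtain ⟨a1, a2, a3, a4, a5, a6⟩ := r1
  obtain ⟨b1, b2, b3, b4, b5, b6⟩ := r2
  let g : P1 →+ Y2.carrier :=
    φ2.comp ((f.toAddMonoidHom.comp P1.subtype).codRestrict P2 (fun x => hP x x.2))
  have hg : ∀ x : P1, g x = φ2 ⟨f x, hP x x.2⟩ := fun x => rfl
  have hker : φ1.ker ≤ g.ker := by
    intro x hx
    rw [AddMonoidHom.mem_ker] at hx ⊢
    rw [hg, b2]
    exact hQ x x.2 ((a2 x).1 hx)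
  let F := φ1.liftOfSurjective a1 ⟨g, hker⟩
  have hF : ∀ x : P1, F (φ1 x) = φ2 ⟨f x, hP x x.2⟩ := by
    intro x
    rw [← hg]
    exact φ1.liftOfRightInverse_comp_apply _ _ ⟨g, hker⟩ x
  refine ⟨F, hF, ?_, ?_, ?_⟩
  · intro s y
    obtain ⟨c, rfl⟩ := hπsurj s
    obtain ⟨x, rfl⟩ := a1 y
    rw [← a3 c x ⟨(c : K) • (x : V1.carrier), hs1 c x x.2⟩ rfl, hF, hF]
    exact b3 c _ _ (f.map_smul (c : K) x)
  · intro h y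
    obtain ⟨x, rfl⟩ := a1 y
    rw [← a4 h x ⟨h • (x : V1.carrier), hh1 h x x.2⟩ rfl, hF, hF]
    exact b4 h _ _ (hf.smulH h x)
  · intro i y hy
    obtain ⟨x, hx, rfl⟩ := a6 i y hy
    rw [hF]
    exact b5 i _ (hf.gr i x hx)

theorem cls_ses {S : Type u} [CommRing S] [Algebra A S] {X Y Z : GrMod A H 𝒜 S}
    (s : GrSES X Y Z) : Y.cls = X.cls + Z.cls := by
  have h : FreeAbelianGroup.of Y - FreeAbelianGroup.of X - FreeAbelianGroup.of Z ∈
      AddSubgroup.closure (grRelSet A H 𝒜 S) :=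
    AddSubgroup.subset_closure ⟨X, Y, Z, ⟨s⟩, rfl⟩
  have h2 : Y.cls - X.cls - Z.cls = 0 :=
    (QuotientAddGroup.eq_zero_iff (N := AddSubgroup.closure (grRelSet A H 𝒜 S)) _).2 h
  rw [sub_sub, sub_eq_zero] at h2
  exact h2

theorem cls_zero {S : Type u} [CommRing S] [Algebra A S] (Y : GrMod A H 𝒜 S)
    (hY : Subsingleton Y.carrier) : Y.cls = 0 := by
  have s : GrSES Y Y Y :=
    { f := AddMonoidHom.id _
      g := AddMonoidHom.id _
      f_smulS := fun _ _ => rfl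
      f_smulH := fun _ _ => rfl
      g_smulS := fun _ _ => rfl
      g_smulH := fun _ _ => rfl
      inj := fun _ _ h => h
      surj := fun y => ⟨y, rfl⟩
      exact := fun y => ⟨fun _ => ⟨y, rfl⟩, fun _ => Subsingleton.elim _ _⟩
      f_graded := fun _ _ h => h
      g_graded := fun _ _ h => h }
  have := cls_ses s
  simpa using this

theorem cls_add_of_red (π : O →+* k) (hπsurj : Function.Surjective π)
    {V1 V2 V3 : GrMod A H 𝒜 K} {P1 Q1 : AddSubgroup V1.carrier}
    {P2 Q2 : AddSubgroup V2.carrier} {P3 Q3 : AddSubgroup V3.carrier}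
    {Y1 Y2 Y3 : GrMod A H 𝒜 k} {φ1 : P1 →+ Y1.carrier}
    {φ2 : P2 →+ Y2.carrier} {φ3 : P3 →+ Y3.carrier}
    (hs1 : ∀ c : O, ∀ x ∈ P1, (c : K) • x ∈ P1)
    (hh1 : ∀ h : H, ∀ x ∈ P1, h • x ∈ P1)
    (hs2 : ∀ c : O, ∀ x ∈ P2, (c : K) • x ∈ P2)
    (hh2 : ∀ h : H, ∀ x ∈ P2, h • x ∈ P2) (hQP2 : Q2 ≤ P2)
    (r1 : Red π V1 P1 Q1 Y1 φ1) (r2 : Red π V2 P2 Q2 Y2 φ2) (r3 : Red π V3 P3 Q3 Y3 φ3)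
    (f : V1.carrier →ₗ[K] V2.carrier) (hf : IsGrHom V1 V2 f) (hP : ∀ x ∈ P1, f x ∈ P2)
    (g : V2.carrier →ₗ[K] V3.carrier) (hg : IsGrHom V2 V3 g) (hPg : ∀ x ∈ P2, g x ∈ P3)
    (hfQ : ∀ x ∈ P1, f x ∈ Q2 ↔ x ∈ Q1)
    (hgs : ∀ z ∈ P3, ∃ y ∈ P2, z - g y ∈ Q3)
    (hex : ∀ y ∈ P2, g y ∈ Q3 ↔ ∃ x ∈ P1, y - f x ∈ Q2) :
    Y2.cls = Y1.cls + Y3.cls := by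
  obtain ⟨F, F1, F2, F3, F4⟩ := red_map π hπsurj hs1 hh1 r1 r2 f hf hP
    (fun x hx hxQ => (hfQ x hx).2 hxQ)
  obtain ⟨G, G1, G2, G3, G4⟩ := red_map π hπsurj hs2 hh2 r2 r3 g hg hPg
    (fun y hy hyQ => (hex y hy).2 ⟨0, P1.zero_mem, by simpa using hyQ⟩)
  obtain ⟨a1, a2, a3, a4, a5, a6⟩ := r1
  obtain ⟨b1, b2, b3, b4, b5, b6⟩ := r2
  obtain ⟨c1, c2, c3, c4, c5, c6⟩ := r3
  refine cls_ses
    { f := F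
      g := G
      f_smulS := F2
      f_smulH := F3
      g_smulS := G2
      g_smulH := G3
      inj := ?_
      surj := ?_
      exact := ?_
      f_graded := F4
      g_graded := G4 }
  · rw [injective_iff_map_eq_zero]
    intro y hy
    obtain ⟨x, rfl⟩ := a1 y
    rw [F1, b2] at hy
    rw [a2]
    exact (hfQ x x.2).1 hy
  · intro z
    obtain ⟨x, rfl⟩ := c1 z
    obtain ⟨y, hy, hyx⟩ := hgs x x.2
    refine ⟨φ2 ⟨y, hy⟩, ?_⟩
    rw [G1]
    have : φ3 (x - ⟨g y, hPg y hy⟩) = 0 := (c2 _).2 hyx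
    rw [map_sub, sub_eq_zero] at this
    exact this.symm
  · intro y
    obtain ⟨x, rfl⟩ := b1 y
    rw [G1, c2]
    refine (hex x x.2).trans ⟨?_, ?_⟩
    · rintro ⟨w, hw, hwQ⟩
      refine ⟨φ1 ⟨w, hw⟩, ?_⟩
      rw [F1]
      have : φ2 (x - ⟨f w, hP w hw⟩) = 0 := (b2 _).2 hwQ
      rw [map_sub, sub_eq_zero] at this
      exact this.symm
    · rintro ⟨w, hw⟩
      obtain ⟨w, rfl⟩ := a1 w
      refine ⟨w, w.2, ?_⟩
      rw [F1] at hw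
      have h4 : φ2 (x - ⟨f w, hP w w.2⟩) = 0 := by rw [map_sub, hw, sub_self]
      exact (b2 _).1 h4

open Classical in
/-- The class of the subquotient `P / Q`. -/
noncomputable def cl (π : O →+* k) (V : GrMod A H 𝒜 K) (P Q : Submodule O V.carrier) :
    Groth A H 𝒜 k :=
  if h : ∃ (Y : GrMod A H 𝒜 k) (φ : P.toAddSubgroup →+ Y.carrier),
      Red π V P.toAddSubgroup Q.toAddSubgroup Y φ then (Classical.choose h).cls else 0

/-- The bundle of hypotheses on the reduction map. -/
structure Hyp (A : Type u) [CommRing A] [Algebra A K] [Algebra A k] (π : O →+* k) : Prop where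
  hAO : ∀ a : A, algebraMap A K a ∈ O
  surj : Function.Surjective π
  ker : ∀ o : O, π o = 0 ↔ ¬ IsUnit o
  hA : ∀ a : A, π ⟨algebraMap A K a, hAO a⟩ = algebraMap A k a

/-- Graded lattices. -/
structure GLat (V : GrMod A H 𝒜 K) (P : Submodule O V.carrier) : Prop extends GSub V P where
  fg : P.FG
  span : Submodule.span K (P : Set V.carrier) = ⊤

theorem GSub.sup {V : GrMod A H 𝒜 K} {P Q : Submodule O V.carrier} (hP : GSub V P)
    (hQ : GSub V Q) : GSub V (P ⊔ Q) := by
  constructor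
  · intro h x hx
    obtain ⟨u, hu, w, hw, rfl⟩ := Submodule.mem_sup.1 hx
    rw [smul_add]
    exact Submodule.add_mem_sup (hP.smulH h u hu) (hQ.smulH h w hw)
  · intro x hx i
    obtain ⟨u, hu, w, hw, rfl⟩ := Submodule.mem_sup.1 hx
    rw [DirectSum.decompose_add]
    exact Submodule.add_mem_sup (hP.gr u hu i) (hQ.gr w hw i)

theorem GSub.inf {V : GrMod A H 𝒜 K} {P Q : Submodule O V.carrier} (hP : GSub V P)
    (hQ : GSub V Q) : GSub V (P ⊓ Q) :=
  ⟨fun h x hx => ⟨hP.smulH h x hx.1, hQ.smulH h x hx.2⟩,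
    fun x hx i => ⟨hP.gr x hx.1 i, hQ.gr x hx.2 i⟩⟩

theorem GSub.scl {V : GrMod A H 𝒜 K} {P : Submodule O V.carrier} (hP : GSub V P) (c : K) :
    GSub V (P.map (scl O V.carrier c)) := by
  constructor
  · rintro h _ ⟨x, hx, rfl⟩
    exact ⟨h • x, hP.smulH h x hx, (V.smul_comm' h c x).symm⟩
  · rintro _ ⟨x, hx, rfl⟩ i
    refine ⟨_, hP.gr x hx i, ?_⟩
    rw [scl_apply, scl_apply, DirectSum.decompose_smul]
    rfl

theorem GSub.mI {V : GrMod A H 𝒜 K} {P : Submodule O V.carrier} (hP : GSub V P) :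
    GSub V (IsLocalRing.maximalIdeal O • P) := by
  constructor
  · intro h x hx
    obtain ⟨c, hc, y, hy, rfl⟩ := mem_mI.1 hx
    exact mem_mI.2 ⟨c, hc, h • y, hP.smulH h y hy, V.smul_comm' h (c : K) y⟩
  · intro x hx i
    obtain ⟨c, hc, y, hy, rfl⟩ := mem_mI.1 hx
    refine mem_mI.2 ⟨c, hc, _, hP.gr y hy i, ?_⟩
    change ((DirectSum.decompose V.grading ((c : K) • y) i : V.grading i) : V.carrier) = _
    rw [DirectSum.decompose_smul]
    rfl

theorem isGrHom_id (V : GrMod A H 𝒜 K) : IsGrHom V V LinearMap.id :=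
  ⟨fun _ _ => rfl, fun _ _ h => h⟩

theorem isGrHom_smul (V : GrMod A H 𝒜 K) (c : K) :
    IsGrHom V V (LinearMap.lsmul K V.carrier c) :=
  ⟨fun h x => (V.smul_comm' h c x).symm, fun i _ h => (V.grading i).smul_mem c h⟩

theorem cl_eq {π : O →+* k} (hy : Hyp A π) {V : GrMod A H 𝒜 K}
    {P Q : Submodule O V.carrier} (hP : GSub V P) (hQP : Q ≤ P)
    {Y : GrMod A H 𝒜 k} {φ : P.toAddSubgroup →+ Y.carrier}
    (r : Red π V P.toAddSubgroup Q.toAddSubgroup Y φ) : cl π V P Q = Y.cls := by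
  have h : ∃ (Y : GrMod A H 𝒜 k) (φ : P.toAddSubgroup →+ Y.carrier),
      Red π V P.toAddSubgroup Q.toAddSubgroup Y φ := ⟨Y, φ, r⟩
  rw [cl, dif_pos h]
  obtain ⟨φ', r'⟩ := Classical.choose_spec h
  have hb : GSub V (⊥ : Submodule O V.carrier) := by
    constructor
    · intro h x hx
      rw [Submodule.mem_bot] at hx ⊢
      rw [hx, smul_zero]
    · intro x hx i
      rw [Submodule.mem_bot] at hx ⊢
      rw [hx]; simp
  obtain ⟨Z, ψ, rz⟩ := exists_red π hy.hAO hy.surj hy.ker hy.hA V ⊥ ⊥ hb hb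
    Submodule.fg_bot (by simp)
  have hZ : Z.cls = 0 := by
    apply cls_zero
    constructor
    intro a b
    obtain ⟨x, rfl⟩ := rz.1 a
    obtain ⟨y, rfl⟩ := rz.1 b
    rw [(rz.2.1 x).2 x.2, (rz.2.1 y).2 y.2]
  have := cls_add_of_red π hy.surj (fun c x hx => P.smul_mem c hx) hP.smulH
    (fun c x hx => P.smul_mem c hx) hP.smulH hQP r r' rz LinearMap.id (isGrHom_id V)
    (fun x hx => hx) 0 ⟨fun h x => by simp, fun i x _ => by simp⟩ (fun x _ => by simp)
    (fun x _ => Iff.rfl)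
    (fun z hz => ⟨0, by simp, by simpa using hz⟩)
    (fun y hy => ⟨fun _ => ⟨y, hy, by simp⟩, fun _ => by simp⟩)
  rw [this, hZ, add_zero]

theorem cl_add {π : O →+* k} (hy : Hyp A π)
    {V1 V2 V3 : GrMod A H 𝒜 K} {P1 Q1 : Submodule O V1.carrier}
    {P2 Q2 : Submodule O V2.carrier} {P3 Q3 : Submodule O V3.carrier}
    (h1 : GLat V1 P1) (h2 : GLat V2 P2) (h3 : GLat V3 P3)
    (k1 : GSub V1 Q1) (k2 : GSub V2 Q2) (k3 : GSub V3 Q3)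
    (l1 : Q1 ≤ P1) (l2 : Q2 ≤ P2) (l3 : Q3 ≤ P3)
    (m1 : IsLocalRing.maximalIdeal O • P1 ≤ Q1)
    (m2 : IsLocalRing.maximalIdeal O • P2 ≤ Q2)
    (m3 : IsLocalRing.maximalIdeal O • P3 ≤ Q3)
    (f : V1.carrier →ₗ[K] V2.carrier) (hf : IsGrHom V1 V2 f) (hP : ∀ x ∈ P1, f x ∈ P2)
    (g : V2.carrier →ₗ[K] V3.carrier) (hg : IsGrHom V2 V3 g) (hPg : ∀ x ∈ P2, g x ∈ P3)
    (hfQ : ∀ x ∈ P1, f x ∈ Q2 ↔ x ∈ Q1)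
    (hgs : ∀ z ∈ P3, ∃ y ∈ P2, z - g y ∈ Q3)
    (hex : ∀ y ∈ P2, g y ∈ Q3 ↔ ∃ x ∈ P1, y - f x ∈ Q2) :
    cl π V2 P2 Q2 = cl π V1 P1 Q1 + cl π V3 P3 Q3 := by
  obtain ⟨Y1, φ1, r1⟩ := exists_red π hy.hAO hy.surj hy.ker hy.hA V1 P1 Q1 h1.toGSub k1 h1.fg m1
  obtain ⟨Y2, φ2, r2⟩ := exists_red π hy.hAO hy.surj hy.ker hy.hA V2 P2 Q2 h2.toGSub k2 h2.fg m2
  obtain ⟨Y3, φ3, r3⟩ := exists_red π hy.hAO hy.surj hy.ker hy.hA V3 P3 Q3 h3.toGSub k3 h3.fg m3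
  rw [cl_eq hy h1.toGSub l1 r1, cl_eq hy h2.toGSub l2 r2, cl_eq hy h3.toGSub l3 r3]
  exact cls_add_of_red π hy.surj (fun c x hx => P1.smul_mem c hx) h1.smulH
    (fun c x hx => P2.smul_mem c hx) h2.smulH l2 r1 r2 r3 f hf hP g hg hPg hfQ hgs hex

theorem mI_le_self {V : Type u} [AddCommGroup V] [Module K V] (P : Submodule O V) :
    IsLocalRing.maximalIdeal O • P ≤ P := Submodule.smul_le_right

end Maps


section TwoLattices

variable {A : Type u} [CommRing A] {H : Type u} [Ring H] [Algebra A H]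
  {𝒜 : ℤ → Submodule A H} {K : Type u} [Field K] [Algebra A K]
  {O : ValuationSubring K} {k : Type u} [Field k] [Algebra A k]

theorem cl_self {π : O →+* k} (hy : Hyp A π) {V : GrMod A H 𝒜 K}
    {P : Submodule O V.carrier} (h : GLat V P) : cl π V P P = 0 := by
  have := cl_add hy h h h h.toGSub h.toGSub h.toGSub le_rfl le_rfl le_rfl
    (mI_le_self P) (mI_le_self P) (mI_le_self P) LinearMap.id (isGrHom_id V) (fun x hx => hx)
    LinearMap.id (isGrHom_id V) (fun x hx => hx) (fun x _ => Iff.rfl)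
    (fun z hz => ⟨0, P.zero_mem, by simpa using hz⟩)
    (fun y hy => ⟨fun _ => ⟨0, P.zero_mem, by simpa using hy⟩, fun _ => hy⟩)
  simpa using this

theorem cl_iso {π : O →+* k} (hy : Hyp A π)
    {V1 V2 : GrMod A H 𝒜 K} {P1 Q1 : Submodule O V1.carrier}
    {P2 Q2 : Submodule O V2.carrier}
    (h1 : GLat V1 P1) (h2 : GLat V2 P2)
    (k1 : GSub V1 Q1) (k2 : GSub V2 Q2)
    (l1 : Q1 ≤ P1) (l2 : Q2 ≤ P2)
    (m1 : IsLocalRing.maximalIdeal O • P1 ≤ Q1)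
    (m2 : IsLocalRing.maximalIdeal O • P2 ≤ Q2)
    (f : V1.carrier →ₗ[K] V2.carrier) (hf : IsGrHom V1 V2 f) (hP : ∀ x ∈ P1, f x ∈ P2)
    (hfQ : ∀ x ∈ P1, f x ∈ Q2 ↔ x ∈ Q1)
    (hs : ∀ y ∈ P2, ∃ x ∈ P1, y - f x ∈ Q2) :
    cl π V2 P2 Q2 = cl π V1 P1 Q1 := by
  have := cl_add hy h1 h2 h2 k1 k2 h2.toGSub l1 l2 le_rfl m1 m2 (mI_le_self P2) f hf hP
    LinearMap.id (isGrHom_id V2) (fun x hx => hx) hfQ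
    (fun z hz => ⟨0, P2.zero_mem, by simpa using hz⟩)
    (fun y hy => ⟨fun _ => hs y hy, fun _ => hy⟩)
  rw [this, cl_self hy h2, add_zero]

/-- The class of the reduction of a lattice. -/
noncomputable def clm (π : O →+* k) (V : GrMod A H 𝒜 K) (P : Submodule O V.carrier) :
    Groth A H 𝒜 k := cl π V P (IsLocalRing.maximalIdeal O • P)

theorem GLat.scl {V : GrMod A H 𝒜 K} {P : Submodule O V.carrier} (h : GLat V P) (c : K)
    (hc : c ≠ 0) : GLat V (P.map (scl O V.carrier c)) := by
  refine ⟨h.toGSub.scl c, h.fg.map _, ?_⟩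
  rw [eq_top_iff, ← h.span, Submodule.span_le]
  intro x hx
  have : x = c⁻¹ • (c • x) := by rw [smul_smul, inv_mul_cancel₀ hc, one_smul]
  rw [this]
  exact Submodule.smul_mem _ _ (Submodule.subset_span ⟨x, hx, rfl⟩)

theorem clm_scl {π : O →+* k} (hy : Hyp A π) {V : GrMod A H 𝒜 K}
    {P : Submodule O V.carrier} (h : GLat V P) (c : K) (hc : c ≠ 0) :
    clm π V (P.map (scl O V.carrier c)) = clm π V P := by
  refine cl_iso hy h (h.scl c hc) h.toGSub.mI (h.scl c hc).toGSub.mI (mI_le_self _)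
    (mI_le_self _) le_rfl le_rfl (LinearMap.lsmul K V.carrier c) (isGrHom_smul V c)
    (fun x hx => ⟨x, hx, rfl⟩) ?_ ?_
  · intro x hx
    constructor
    · intro h1
      obtain ⟨d, hd, _, ⟨y, hyP, rfl⟩, hxy⟩ := mem_mI.1 h1
      refine mem_mI.2 ⟨d, hd, y, hyP, ?_⟩
      have h2 : c • x = c • ((d : K) • y) := by
        rw [smul_comm]
        exact hxy
      exact smul_right_injective _ hc h2
    · intro h1
      obtain ⟨d, hd, y, hyP, rfl⟩ := mem_mI.1 h1
      refine mem_mI.2 ⟨d, hd, _, ⟨y, hyP, rfl⟩, ?_⟩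
      change c • (d : K) • y = (d : K) • c • y
      rw [smul_comm]
  · rintro _ ⟨x, hx, rfl⟩
    exact ⟨x, hx, by rw [scl_apply]; simp⟩

/-- Adjacent lattices have the same class. -/
theorem clm_adj {π : O →+* k} (hy : Hyp A π) {V : GrMod A H 𝒜 K}
    {P P' : Submodule O V.carrier} (h : GLat V P) (h' : GLat V P') (s : K)
    (hle : P' ≤ P) (hs : ∀ x ∈ P, s • x ∈ P')
    (h3 : ∀ x ∈ P, s • x ∈ IsLocalRing.maximalIdeal O • P' ↔
      x ∈ P' ⊔ IsLocalRing.maximalIdeal O • P)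
    (h4 : ∀ y ∈ P', y ∈ P' ⊓ IsLocalRing.maximalIdeal O • P ↔
      ∃ x ∈ P, y - s • x ∈ IsLocalRing.maximalIdeal O • P') :
    clm π V P = clm π V P' := by
  have hmm : IsLocalRing.maximalIdeal O • P' ≤ IsLocalRing.maximalIdeal O • P :=
    Submodule.smul_mono le_rfl hle
  have g1 : GSub V (P' ⊓ IsLocalRing.maximalIdeal O • P) := h'.toGSub.inf h.toGSub.mI
  have g2 : GSub V (P' ⊔ IsLocalRing.maximalIdeal O • P) := h'.toGSub.sup h.toGSub.mI
  have e1 : clm π V P = cl π V P' (P' ⊓ IsLocalRing.maximalIdeal O • P) +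
      cl π V P (P' ⊔ IsLocalRing.maximalIdeal O • P) := by
    refine cl_add hy h' h h g1 h.toGSub.mI g2 inf_le_left (mI_le_self _)
      (sup_le hle (mI_le_self _)) (le_inf (mI_le_self _) hmm) le_rfl le_sup_right
      LinearMap.id (isGrHom_id V) (fun x hx => hle hx)
      LinearMap.id (isGrHom_id V) (fun x hx => hx) ?_ ?_ ?_
    · intro x hx
      exact ⟨fun h => ⟨hx, h⟩, fun h => h.2⟩
    · intro z hz
      exact ⟨z, hz, by simp⟩
    · intro y _
      constructor
      · intro hyy
        obtain ⟨u, hu, w, hw, rfl⟩ := Submodule.mem_sup.1 hyy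
        exact ⟨u, hu, by simpa using hw⟩
      · rintro ⟨x, hx, hxy⟩
        have : y = x + (y - x) := by abel
        change y ∈ _
        rw [this]
        exact Submodule.add_mem_sup hx hxy
  have e2 : clm π V P' = cl π V P (P' ⊔ IsLocalRing.maximalIdeal O • P) +
      cl π V P' (P' ⊓ IsLocalRing.maximalIdeal O • P) := by
    refine cl_add hy h h' h' g2 h'.toGSub.mI g1
      (sup_le hle (mI_le_self _)) (mI_le_self _) inf_le_left
      le_sup_right le_rfl (le_inf (mI_le_self _) hmm)
      (LinearMap.lsmul K V.carrier s) (isGrHom_smul V s) hs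
      LinearMap.id (isGrHom_id V) (fun x hx => hx) h3 ?_ h4
    intro z hz
    exact ⟨z, hz, by simp⟩
  rw [e1, e2, add_comm]

theorem two_lat {π : O →+* k} (hy : Hyp A π) {V : GrMod A H 𝒜 K}
    {L L' : Submodule O V.carrier} (h : GLat V L) (h' : GLat V L') :
    clm π V L = clm π V L' := by
  classical
  obtain ⟨E, a, ha, hL, hL'⟩ := simul _ V.carrier rfl L L' h.fg h'.fg h.span h'.span
  let Λ : K → Submodule O V.carrier := fun c => L' ⊔ L.map (scl O V.carrier c)
  have hΛ : ∀ c, c ≠ 0 → ∀ x, x ∈ Λ c ↔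
      ∀ i, O.valuation (E x i) ≤ max (O.valuation (a i)) (O.valuation c) :=
    fun c hc x => box_sup E a L L' hL hL' c hc x
  have gΛ : ∀ c, GLat V (Λ c) := by
    intro c
    refine ⟨h'.toGSub.sup (h.toGSub.scl c), h'.fg.sup (h.fg.map _), ?_⟩
    rw [eq_top_iff, ← h'.span]
    exact Submodule.span_mono (fun x hx => Submodule.mem_sup_left hx)
  have step : ∀ c c', c ≠ 0 → c' ≠ 0 → O.valuation c' < O.valuation c →
      (∀ i, O.valuation (a i) < O.valuation c → O.valuation (a i) ≤ O.valuation c') →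
      clm π V (Λ c) = clm π V (Λ c') := by
    intro c c' hc hc' hlt hadj
    have hvc : O.valuation c ≠ 0 := by simpa using hc
    let D : K → Fin _ → K := fun d i => if O.valuation d ≤ O.valuation (a i) then a i else d
    have hD0 : ∀ d, d ≠ 0 → ∀ i, D d i ≠ 0 := by
      intro d hd i
      simp only [D]
      split_ifs
      · exact ha i
      · exact hd
    have hDv : ∀ d i, O.valuation (D d i) = max (O.valuation (a i)) (O.valuation d) := by
      intro d i
      simp only [D]
      split_ifs with hi
      · rw [max_eq_left hi]
      · rw [max_eq_right (not_le.1 hi).le]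
    have hΛD : ∀ d, d ≠ 0 → ∀ x, x ∈ Λ d ↔
        ∀ i, O.valuation (E x i) ≤ O.valuation (D d i) := by
      intro d hd x
      rw [hΛ d hd]
      simp only [hDv]
    have hs : O.valuation (c' / c) < 1 := by
      rw [map_div₀]
      exact (div_lt_one₀ (zero_lt_iff.2 hvc)).2 hlt
    obtain ⟨q1, q2, q3, q4⟩ := adj E (D c) (D c') (hD0 c hc) (hD0 c' hc') (Λ c) (Λ c')
      (hΛD c hc) (hΛD c' hc') (c' / c) (div_ne_zero hc' hc) hs (by
        intro i
        rw [hDv, hDv]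
        by_cases hi : O.valuation (a i) < O.valuation c
        · right
          rw [max_eq_right hi.le, max_eq_right (hadj i hi), map_div₀, div_mul_cancel₀ _ hvc]
        · left
          rw [max_eq_left (not_lt.1 hi), max_eq_left (hlt.le.trans (not_lt.1 hi))])
    exact clm_adj hy (gΛ c) (gΛ c') (c' / c) q1 q2 q3 q4
  have main : ∀ N : ℕ, ∀ c, c ≠ 0 →
      (Finset.univ.filter fun i => O.valuation (a i) < O.valuation c).card = N →
      clm π V (Λ c) = clm π V L' := by
    intro N
    induction N using Nat.strong_induction_on with
    | _ N ih =>
      intro c hc hN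
      rcases Finset.eq_empty_or_nonempty
        (Finset.univ.filter fun i => O.valuation (a i) < O.valuation c) with he | hne
      · have : Λ c = L' := by
          ext x
          rw [hΛ c hc, hL']
          refine forall_congr' fun i => ?_
          have hi : ¬ O.valuation (a i) < O.valuation c := by
            intro hlt
            have : i ∈ (Finset.univ.filter fun i => O.valuation (a i) < O.valuation c) := by
              simpa using hlt
            rw [he] at this
            simp at this
          rw [max_eq_left (not_lt.1 hi)]
        rw [this]
      · obtain ⟨i0, hi0, hmax⟩ := Finset.exists_max_image _ (fun i => O.valuation (a i)) hne
        simp only [Finset.mem_filter, Finset.mem_univ, true_and] at hi0 hmax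
        rw [step c (a i0) hc (ha i0) hi0 hmax]
        refine ih _ ?_ (a i0) (ha i0) rfl
        rw [← hN]
        apply Finset.card_lt_card
        rw [Finset.ssubset_iff_of_subset]
        · exact ⟨i0, by simpa using hi0, by simp⟩
        · intro i hi
          simp only [Finset.mem_filter, Finset.mem_univ, true_and] at hi ⊢
          exact hi.trans hi0
  obtain ⟨c, hc, hmax⟩ : ∃ c : K, c ≠ 0 ∧ ∀ i, O.valuation (a i) ≤ O.valuation c := by
    rcases isEmpty_or_nonempty (Fin (Module.finrank K V.carrier)) with he | hne
    · exact ⟨1, one_ne_zero, fun i => he.elim i⟩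
    · obtain ⟨i0, hi0⟩ := Finite.exists_max (fun i => O.valuation (a i))
      exact ⟨a i0, ha i0, hi0⟩
  have hvc : O.valuation c ≠ 0 := by simpa using hc
  have hΛc : Λ c = L.map (scl O V.carrier c) := by
    refine le_antisymm (fun x hx => ?_) le_sup_right
    refine ⟨c⁻¹ • x, (hL _).2 fun i => ?_, ?_⟩
    · have h1 := (hΛ c hc x).1 hx i
      rw [max_eq_right (hmax i)] at h1
      rw [map_smul, Pi.smul_apply, smul_eq_mul, map_mul, map_inv₀]
      calc _ ≤ (O.valuation c)⁻¹ * O.valuation c := by gcongr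
        _ = 1 := inv_mul_cancel₀ hvc
    · rw [scl_apply, smul_smul, mul_inv_cancel₀ hc, one_smul]
  rw [← clm_scl hy h c hc, ← hΛc]
  exact main _ c hc rfl

end TwoLattices


section Final

variable {A : Type u} [CommRing A] {H : Type u} [Ring H] [Algebra A H]
  {𝒜 : ℤ → Submodule A H} {K : Type u} [Field K] [Algebra A K]
  {O : ValuationSubring K} {k : Type u} [Field k] [Algebra A k]

theorem hom_decompose {V W : GrMod A H 𝒜 K} (f : V.carrier →+ W.carrier) (σ : ℤ → ℤ)
    (hσ : Injective σ) (hf : ∀ i, ∀ x ∈ V.grading i, f x ∈ W.grading (σ i))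
    (x : V.carrier) (i : ℤ) :
    ((DirectSum.decompose W.grading (f x) (σ i) : W.grading (σ i)) : W.carrier) =
      f (DirectSum.decompose V.grading x i : V.grading i) := by
  induction x using DirectSum.Decomposition.inductionOn V.grading with
  | zero => simp
  | @homogeneous m x =>
    by_cases hm : m = i
    · subst hm
      rw [DirectSum.decompose_of_mem_same _ (hf m x x.2),
        DirectSum.decompose_of_mem_same _ x.2]
    · rw [DirectSum.decompose_of_mem_ne _ (hf m x x.2) (fun h => hm (hσ h)),
        DirectSum.decompose_of_mem_ne _ x.2 hm, map_zero]
  | add x y hx hy => simp [DirectSum.decompose_add, hx, hy]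

theorem exists_lat [Module.Finite A H] [DirectSum.Decomposition 𝒜]
    (hAO : ∀ a : A, algebraMap A K a ∈ O)
    (V : GrMod A H 𝒜 K) : ∃ L : Submodule O V.carrier, GLat V L := by
  classical
  obtain ⟨s, hs⟩ := V.fin.fg_top
  obtain ⟨g, hg⟩ := (inferInstance : Module.Finite A H).fg_top
  let T : Finset V.carrier := s.biUnion (fun x =>
    (DirectSum.decompose V.grading x).support.image
      (fun i => ((DirectSum.decompose V.grading x i : V.grading i) : V.carrier)))
  have hT : ∀ t ∈ T, ∃ i, t ∈ V.grading i := by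
    intro t ht
    simp only [T, Finset.mem_biUnion, Finset.mem_image] at ht
    obtain ⟨x, _, i, _, rfl⟩ := ht
    exact ⟨i, SetLike.coe_mem _⟩
  have hTs : ∀ M : Submodule K V.carrier, (∀ t ∈ T, t ∈ M) → M = ⊤ := by
    intro M hM
    rw [eq_top_iff, ← hs, Submodule.span_le]
    intro x hx
    rw [← DirectSum.sum_support_decompose V.grading x]
    refine Submodule.sum_mem _ fun i hi => hM _ ?_
    simp only [T, Finset.mem_biUnion, Finset.mem_image]
    exact ⟨x, hx, i, hi, rfl⟩
  let L : Submodule O V.carrier := Submodule.span O {y | ∃ h : H, ∃ t ∈ T, y = h • t}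
  have hmem : ∀ h : H, ∀ t ∈ T, h • t ∈ L := fun h t ht => Submodule.subset_span ⟨h, t, ht, rfl⟩
  refine ⟨L, ⟨⟨?_, ?_⟩, ?_, ?_⟩⟩
  · intro h x hx
    induction hx using Submodule.span_induction with
    | mem x hx =>
      obtain ⟨h', t, ht, rfl⟩ := hx
      rw [← mul_smul]
      exact hmem _ t ht
    | zero => rw [smul_zero]; exact L.zero_mem
    | add x y _ _ h1 h2 => rw [smul_add]; exact L.add_mem h1 h2
    | smul c x _ h1 =>
      have : h • c • x = c • h • x := V.smul_comm' h (c : K) x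
      rw [this]
      exact L.smul_mem c h1
  · intro x hx i
    induction hx using Submodule.span_induction with
    | mem x hx =>
      obtain ⟨h, t, ht, rfl⟩ := hx
      obtain ⟨m, hm⟩ := hT t ht
      rw [← DirectSum.sum_support_decompose 𝒜 h, Finset.sum_smul, DirectSum.decompose_sum,
        DFinsupp.finsetSum_apply, AddSubmonoidClass.coe_finsetSum]
      refine Submodule.sum_mem _ fun j _ => ?_
      have h1 := V.grading_smul j m _ (SetLike.coe_mem (DirectSum.decompose 𝒜 h j)) t hm
      by_cases hji : j + m = i
      · subst hji
        rw [DirectSum.decompose_of_mem_same _ h1]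
        exact hmem _ t ht
      · rw [DirectSum.decompose_of_mem_ne _ h1 hji]
        exact L.zero_mem
    | zero => simp
    | add x y _ _ h1 h2 => rw [DirectSum.decompose_add]; exact L.add_mem h1 h2
    | smul c x _ h1 =>
      have : ((DirectSum.decompose V.grading (c • x) i : V.grading i) : V.carrier) =
          c • ((DirectSum.decompose V.grading x i : V.grading i) : V.carrier) := by
        change ((DirectSum.decompose V.grading ((c : K) • x) i : V.grading i) : V.carrier) = _
        rw [DirectSum.decompose_smul]
        rfl
      rw [this]
      exact L.smul_mem c h1
  · refine ⟨Finset.image₂ (fun (h : H) (t : V.carrier) => h • t) g T, le_antisymm ?_ ?_⟩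
    · rw [Submodule.span_le]
      intro x hx
      obtain ⟨h, _, t, ht, rfl⟩ := Finset.mem_image₂.1 (Finset.mem_coe.1 hx)
      exact hmem h t ht
    · rw [Submodule.span_le]
      rintro _ ⟨h, t, ht, rfl⟩
      have hh : h ∈ Submodule.span A (g : Set H) := by rw [hg]; trivial
      induction hh using Submodule.span_induction with
      | mem h hh =>
        exact Submodule.subset_span (Finset.mem_coe.2 (Finset.mem_image₂.2 ⟨h, hh, t, ht, rfl⟩))
      | zero => rw [zero_smul]; exact Submodule.zero_mem _
      | add x y _ _ h1 h2 => rw [add_smul]; exact Submodule.add_mem _ h1 h2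
      | smul a x _ h1 =>
        rw [Algebra.smul_def, mul_smul, V.compat]
        exact Submodule.smul_mem _ (⟨algebraMap A K a, hAO a⟩ : O) h1
  · apply hTs
    intro t ht
    apply Submodule.subset_span
    have := hmem 1 t ht
    rwa [one_smul] at this

theorem exists_den {V : Type u} [AddCommGroup V] [Module K V] {L : Submodule O V}
    (hs : Submodule.span K (L : Set V) = ⊤) (x : V) : ∃ c : O, c ≠ 0 ∧ (c : K) • x ∈ L := by
  have hx : x ∈ Submodule.span K (L : Set V) := by rw [hs]; trivial
  induction hx using Submodule.span_induction with
  | mem x hx => exact ⟨1, one_ne_zero, by simpa using hx⟩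
  | zero => exact ⟨1, one_ne_zero, by simp⟩
  | add x y _ _ h1 h2 =>
    obtain ⟨c, hc, h1⟩ := h1
    obtain ⟨d, hd, h2⟩ := h2
    refine ⟨c * d, mul_ne_zero hc hd, ?_⟩
    rw [smul_add]
    refine L.add_mem ?_ ?_
    · have : ((c * d : O) : K) • x = d • ((c : K) • x) := by
        change ((c : K) * (d : K)) • x = (d : K) • _
        rw [smul_smul, mul_comm]
      rw [this]; exact L.smul_mem d h1
    · have : ((c * d : O) : K) • y = c • ((d : K) • y) := by
        change ((c : K) * (d : K)) • y = (c : K) • _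
        rw [smul_smul]
      rw [this]; exact L.smul_mem c h2
  | smul t x _ h1 =>
    obtain ⟨c, hc, h1⟩ := h1
    by_cases ht0 : t = 0
    · exact ⟨1, one_ne_zero, by simp [ht0]⟩
    rcases O.mem_or_inv_mem t with ht | ht
    · refine ⟨c, hc, ?_⟩
      rw [smul_comm]
      exact L.smul_mem (⟨t, ht⟩ : O) h1
    · refine ⟨c * ⟨t⁻¹, ht⟩, mul_ne_zero hc ?_, ?_⟩
      · intro h
        exact inv_ne_zero ht0 (congrArg Subtype.val h)
      · have : ((c * ⟨t⁻¹, ht⟩ : O) : K) • t • x = (c : K) • x := by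
          change ((c : K) * t⁻¹) • t • x = _
          rw [smul_smul, mul_assoc, inv_mul_cancel₀ ht0, mul_one]
        rw [this]; exact h1

theorem clm_ses {π : O →+* k} (hy : Hyp A π) {X Y Z : GrMod A H 𝒜 K} (s : GrSES X Y Z)
    {L : Submodule O Y.carrier} (hL : GLat Y L) :
    ∃ (L1 : Submodule O X.carrier) (L3 : Submodule O Z.carrier), GLat X L1 ∧ GLat Z L3 ∧
      clm π Y L = clm π X L1 + clm π Z L3 := by
  let f : X.carrier →ₗ[K] Y.carrier := { s.f with map_smul' := s.f_smulS }
  let g : Y.carrier →ₗ[K] Z.carrier := { s.g with map_smul' := s.g_smulS }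
  have hf : IsGrHom X Y f := ⟨s.f_smulH, s.f_graded⟩
  have hg : IsGrHom Y Z g := ⟨s.g_smulH, s.g_graded⟩
  have finj : Injective f := s.inj
  have gsurj : Surjective g := s.surj
  have hex : ∀ y, g y = 0 ↔ ∃ x, f x = y := s.exact
  have fdec : ∀ x i, ((DirectSum.decompose Y.grading (f x) i : Y.grading i) : Y.carrier) =
      f (DirectSum.decompose X.grading x i : X.grading i) :=
    fun x i => hom_decompose s.f id injective_id s.f_graded x i
  have gdec : ∀ x i, ((DirectSum.decompose Z.grading (g x) i : Z.grading i) : Z.carrier) =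
      g (DirectSum.decompose Y.grading x i : Y.grading i) :=
    fun x i => hom_decompose s.g id injective_id s.g_graded x i
  let L1 : Submodule O X.carrier := L.comap (f.restrictScalars O)
  let L3 : Submodule O Z.carrier := L.map (g.restrictScalars O)
  have mem1 : ∀ x, x ∈ L1 ↔ f x ∈ L := fun x => Iff.rfl
  have g3 : GLat Z L3 := by
    refine ⟨⟨?_, ?_⟩, hL.fg.map _, ?_⟩
    · rintro h _ ⟨y, hyL, rfl⟩
      exact ⟨h • y, hL.smulH h y hyL, hg.smulH h y⟩
    · rintro _ ⟨y, hyL, rfl⟩ i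
      exact ⟨_, hL.gr y hyL i, (gdec y i).symm⟩
    · have : (L3 : Set Z.carrier) = Set.image g (L : Set Y.carrier) := by
        ext; simp [L3]
      rw [this, ← Submodule.map_span, hL.span, Submodule.map_top, LinearMap.range_eq_top.2 gsurj]
  have g1 : GLat X L1 := by
    refine ⟨⟨?_, ?_⟩, ?_, ?_⟩
    · intro h x hx
      rw [mem1, hf.smulH]
      exact hL.smulH h _ hx
    · intro x hx i
      rw [mem1, ← fdec]
      exact hL.gr _ hx i
    · have i1 : Module.Free O L3 := free_of_fg L3 g3.fg
      have i2 : Module.Finite O L3 := Module.Finite.iff_fg.2 g3.fg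
      have i3 : Module.Finite O L := Module.Finite.iff_fg.2 hL.fg
      have i4 : Module.FinitePresentation O L3 := Module.finitePresentation_of_projective O L3
      let g' : L →ₗ[O] L3 := (g.restrictScalars O).restrict (fun x hx => ⟨x, hx, rfl⟩)
      have hg' : Surjective g' := by
        rintro ⟨_, ⟨y, hyL, rfl⟩⟩
        exact ⟨⟨y, hyL⟩, rfl⟩
      have hker := Module.FinitePresentation.fg_ker g' hg'
      have h1 : L1.map (f.restrictScalars O) = (LinearMap.ker g').map L.subtype := by
        ext y
        constructor
        · rintro ⟨x, hx, rfl⟩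
          refine ⟨⟨f x, hx⟩, ?_, rfl⟩
          apply Subtype.ext
          exact (hex _).2 ⟨x, rfl⟩
        · rintro ⟨y, hyk, rfl⟩
          have : g (y : Y.carrier) = 0 := congrArg Subtype.val hyk
          obtain ⟨x, hx⟩ := (hex _).1 this
          refine ⟨x, ?_, hx⟩
          change f x ∈ L
          rw [hx]
          exact y.2
      refine Submodule.fg_of_fg_map_injective (f.restrictScalars O) finj ?_
      rw [h1]
      exact hker.map _
    · rw [eq_top_iff]
      intro x _
      obtain ⟨c, hc, hcx⟩ := exists_den hL.span (f x)
      have hc' : (c : K) ≠ 0 := by simpa using hc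
      have : x = (c : K)⁻¹ • ((c : K) • x) := by
        rw [smul_smul, inv_mul_cancel₀ hc', one_smul]
      rw [this]
      refine Submodule.smul_mem _ _ (Submodule.subset_span ?_)
      change f ((c : K) • x) ∈ L
      rw [map_smul]
      exact hcx
  refine ⟨L1, L3, g1, g3, ?_⟩
  refine cl_add hy g1 hL g3 g1.toGSub.mI hL.toGSub.mI g3.toGSub.mI (mI_le_self _)
    (mI_le_self _) (mI_le_self _) le_rfl le_rfl le_rfl f hf (fun x hx => hx) g hg
    (fun y hyL => ⟨y, hyL, rfl⟩) ?_ ?_ ?_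
  · intro x hx
    constructor
    · intro h
      obtain ⟨c, hc, y, hyL, hxy⟩ := mem_mI.1 h
      by_cases hc0 : (c : K) = 0
      · have : f x = 0 := by
          rw [hxy]
          change (c : K) • y = 0
          rw [hc0, zero_smul]
        have : x = 0 := finj (by rw [this, map_zero])
        rw [this]
        exact Submodule.zero_mem _
      · refine mem_mI.2 ⟨c, hc, (c : K)⁻¹ • x, ?_, ?_⟩
        · rw [mem1, map_smul, hxy]
          change (c : K)⁻¹ • (c : K) • y ∈ L
          rw [smul_smul, inv_mul_cancel₀ hc0, one_smul]
          exact hyL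
        · change x = (c : K) • (c : K)⁻¹ • x
          rw [smul_smul, mul_inv_cancel₀ hc0, one_smul]
    · intro h
      obtain ⟨c, hc, y, hyL, rfl⟩ := mem_mI.1 h
      exact mem_mI.2 ⟨c, hc, f y, hyL, f.map_smul (c : K) y⟩
  · rintro _ ⟨y, hyL, rfl⟩
    refine ⟨y, hyL, ?_⟩
    have : (g.restrictScalars O) y - g y = 0 := sub_self _
    rw [this]
    exact Submodule.zero_mem _
  · intro y hyL
    constructor
    · intro h
      obtain ⟨c, hc, _, ⟨w, hw, rfl⟩, hyw⟩ := mem_mI.1 h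
      have h1 : g (y - (c : K) • w) = 0 := by
        rw [map_sub, map_smul, sub_eq_zero]
        exact hyw
      obtain ⟨x, hx⟩ := (hex _).1 h1
      refine ⟨x, ?_, mem_mI.2 ⟨c, hc, w, hw, ?_⟩⟩
      · rw [mem1, hx]
        exact L.sub_mem hyL (L.smul_mem c hw)
      · rw [hx]
        change y - (y - (c : K) • w) = (c : K) • w
        abel
    · rintro ⟨x, _, hxy⟩
      obtain ⟨c, hc, w, hw, hyw⟩ := mem_mI.1 hxy
      refine mem_mI.2 ⟨c, hc, g w, ⟨w, hw, rfl⟩, ?_⟩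
      have h1 : g (f x) = 0 := (hex _).2 ⟨x, rfl⟩
      have h2 : g (y - f x) = (c : K) • g w := by
        rw [hyw]
        exact g.map_smul (c : K) w
      rw [map_sub, h1, sub_zero] at h2
      exact h2

theorem lat_of_isLattice {V : GrMod A H 𝒜 K} {LV : AddSubgroup V.carrier}
    (h : V.IsLattice O LV) : ∃ P : Submodule O V.carrier, P.toAddSubgroup = LV ∧ GLat V P := by
  obtain ⟨h1, h2, h3, n, b, hb1, hb2, hb3, hb4⟩ := h
  let P : Submodule O V.carrier :=
    { carrier := LV
      add_mem' := fun ha hb => LV.add_mem ha hb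
      zero_mem' := LV.zero_mem
      smul_mem' := fun c x hx => h1 (c : K) c.2 x hx }
  refine ⟨P, rfl, ⟨h2, h3⟩, ?_, ?_⟩
  · classical
    refine ⟨Finset.univ.image b, le_antisymm ?_ ?_⟩
    · rw [Submodule.span_le]
      intro x hx
      simp only [Finset.coe_image, Finset.coe_univ, Set.image_univ, Set.mem_range] at hx
      obtain ⟨m, rfl⟩ := hx
      exact hb3 m
    · intro x hx
      obtain ⟨c, hc, rfl⟩ := hb4 x hx
      refine Submodule.sum_mem _ fun m _ => ?_
      exact Submodule.smul_mem _ (⟨c m, hc m⟩ : O) (Submodule.subset_span (by simp))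
  · rw [eq_top_iff, ← hb2]
    apply Submodule.span_mono
    rintro _ ⟨m, rfl⟩
    exact hb3 m

theorem mSub_eq {V : GrMod A H 𝒜 K} (P : Submodule O V.carrier) :
    GrMod.mSub O V P.toAddSubgroup = (IsLocalRing.maximalIdeal O • P).toAddSubgroup := by
  apply le_antisymm
  · refine (AddSubgroup.closure_le _).2 ?_
    rintro _ ⟨c, hc, y, hyL, rfl⟩
    exact mem_mI.2 ⟨c, hc, y, hyL, rfl⟩
  · intro x hx
    obtain ⟨c, hc, y, hyL, rfl⟩ := mem_mI.1 hx
    exact AddSubgroup.subset_closure ⟨c, hc, y, hyL, rfl⟩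

theorem shift_internal (Y : GrMod A H 𝒜 k) (j : ℤ) :
    DirectSum.IsInternal (fun i : ℤ => Y.grading (i - j)) := by
  classical
  refine decomposition_of_proj (fun i => Y.grading (i - j))
    (fun i =>
      { toFun := fun x => (DirectSum.decompose Y.grading x (i - j) : Y.grading (i - j))
        map_zero' := by simp
        map_add' := fun x y => by simp [DirectSum.decompose_add] }) ?_ ?_ ?_
  · intro i x hx
    exact DirectSum.decompose_of_mem_same _ hx
  · intro i m him x hx
    refine DirectSum.decompose_of_mem_ne _ hx ?_
    intro h
    exact him (by omega)
  · intro x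
    rw [← DirectSum.sum_support_decompose Y.grading x]
    refine Submodule.sum_mem _ fun m _ => ?_
    refine Submodule.mem_iSup_of_mem (m + j) ?_
    have h : m + j - j = m := by omega
    rw [h]
    exact SetLike.coe_mem _

/-- The shift of a graded module. -/
noncomputable def shiftGr (Y : GrMod A H 𝒜 k) (j : ℤ) : GrMod A H 𝒜 k :=
  { carrier := Y.carrier
    smul_comm' := Y.smul_comm'
    compat := Y.compat
    grading := fun i => Y.grading (i - j)
    decomp := (shift_internal Y j).chooseDecomposition
    grading_smul := by
      intro i m h hh x hx
      have := Y.grading_smul i (m - j) h hh x hx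
      rwa [← add_sub_assoc] at this }

theorem clm_shift {π : O →+* k} (hy : Hyp A π) {V V' : GrMod A H 𝒜 K} {j : ℤ}
    (hs : V'.IsShiftOf V j) {P : Submodule O V.carrier} (hP : GLat V P) :
    ∃ (P' : Submodule O V'.carrier) (Y Y' : GrMod A H 𝒜 k), GLat V' P' ∧
      clm π V P = Y.cls ∧ clm π V' P' = Y'.cls ∧ Y'.IsShiftOf Y j := by
  obtain ⟨e, e1, e2, e3⟩ := hs
  obtain ⟨Y, φ, r⟩ := exists_red π hy.hAO hy.surj hy.ker hy.hA V P
    (IsLocalRing.maximalIdeal O • P) hP.toGSub hP.toGSub.mI hP.fg le_rfl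
  have hdec : ∀ x i, ((DirectSum.decompose V.grading (e x) (i - j) : V.grading (i - j)) :
      V.carrier) = e (DirectSum.decompose V'.grading x i : V'.grading i) :=
    fun x i => hom_decompose (e : V'.carrier →+ V.carrier) (fun i => i - j)
      (fun a b h => by simpa using h) e3 x i
  let el : V'.carrier →ₗ[K] V.carrier :=
    { toFun := e, map_add' := e.map_add, map_smul' := e1 }
  let P' : Submodule O V'.carrier := P.comap (el.restrictScalars O)
  have mem1 : ∀ x, x ∈ P' ↔ e x ∈ P := fun x => Iff.rfl
  have hmap : P'.map (el.restrictScalars O) = P :=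
    Submodule.map_comap_eq_of_surjective e.surjective P
  have g : GLat V' P' := by
    refine ⟨⟨?_, ?_⟩, ?_, ?_⟩
    · intro h x hx
      rw [mem1, e2]
      exact hP.smulH h _ hx
    · intro x hx i
      rw [mem1, ← hdec]
      exact hP.gr _ hx _
    · refine Submodule.fg_of_fg_map_injective (el.restrictScalars O) e.injective ?_
      rw [hmap]
      exact hP.fg
    · rw [eq_top_iff]
      intro x _
      obtain ⟨c, hc, hcx⟩ := exists_den hP.span (e x)
      have hc' : (c : K) ≠ 0 := by simpa using hc
      have : x = (c : K)⁻¹ • ((c : K) • x) := by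
        rw [smul_smul, inv_mul_cancel₀ hc', one_smul]
      rw [this]
      refine Submodule.smul_mem _ _ (Submodule.subset_span ?_)
      change e ((c : K) • x) ∈ P
      rw [e1]
      exact hcx
  have hm : ∀ x, x ∈ IsLocalRing.maximalIdeal O • P' ↔
      e x ∈ IsLocalRing.maximalIdeal O • P := by
    intro x
    constructor
    · intro h
      obtain ⟨c, hc, y, hyP, rfl⟩ := mem_mI.1 h
      exact mem_mI.2 ⟨c, hc, e y, hyP, e1 (c : K) y⟩
    · intro h
      obtain ⟨c, hc, y, hyP, hxy⟩ := mem_mI.1 h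
      refine mem_mI.2 ⟨c, hc, e.symm y, ?_, ?_⟩
      · rw [mem1, e.apply_symm_apply]
        exact hyP
      · apply e.injective
        rw [hxy]
        have := e1 (c : K) (e.symm y)
        rw [e.apply_symm_apply] at this
        exact this.symm
  let φ' : P'.toAddSubgroup →+ (shiftGr Y j).carrier :=
    { toFun := fun x => φ ⟨e (x : V'.carrier), x.2⟩
      map_zero' := by
        have : (⟨e ((0 : P'.toAddSubgroup) : V'.carrier), (0 : P'.toAddSubgroup).2⟩ :
            P.toAddSubgroup) = 0 := Subtype.ext e.map_zero
        rw [this]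
        exact φ.map_zero
      map_add' := by
        intro x y
        have : (⟨e ((x + y : P'.toAddSubgroup) : V'.carrier), (x + y).2⟩ : P.toAddSubgroup) =
            ⟨e (x : V'.carrier), x.2⟩ + ⟨e (y : V'.carrier), y.2⟩ :=
          Subtype.ext (e.map_add _ _)
        rw [this]
        exact φ.map_add _ _ }
  obtain ⟨r1, r2, r3, r4, r5, r6⟩ := id r
  have r' : Red π V' P'.toAddSubgroup (IsLocalRing.maximalIdeal O • P').toAddSubgroup
      (shiftGr Y j) φ' := by
    refine ⟨?_, ?_, ?_, ?_, ?_, ?_⟩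
    · intro y
      obtain ⟨x, hx⟩ := r1 y
      refine ⟨⟨e.symm x, ?_⟩, ?_⟩
      · change e (e.symm (x : V.carrier)) ∈ P
        rw [e.apply_symm_apply]
        exact x.2
      · rw [← hx]
        exact congrArg φ (Subtype.ext (e.apply_symm_apply _))
    · intro x
      exact (r2 _).trans (hm _).symm
    · intro c x y h
      refine r3 c _ _ ?_
      change e (y : V'.carrier) = (c : K) • e (x : V'.carrier)
      rw [h, e1]
    · intro h x y hxy
      refine r4 h _ _ ?_
      change e (y : V'.carrier) = h • e (x : V'.carrier)
      rw [hxy, e2]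
    · intro i x hx
      exact r5 (i - j) _ (e3 i x hx)
    · intro i y hyi
      obtain ⟨x, hx, hxy⟩ := r6 (i - j) y hyi
      refine ⟨⟨e.symm x, ?_⟩, ?_, ?_⟩
      · change e (e.symm (x : V.carrier)) ∈ P
        rw [e.apply_symm_apply]
        exact x.2
      · have h1 := hdec (e.symm x) i
        rw [e.apply_symm_apply, DirectSum.decompose_of_mem_same _ hx] at h1
        have h2 : e.symm (x : V.carrier) =
            (DirectSum.decompose V'.grading (e.symm (x : V.carrier)) i : V'.grading i) := by
          apply e.injective
          rw [e.apply_symm_apply]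
          exact h1
        change e.symm (x : V.carrier) ∈ V'.grading i
        rw [h2]
        exact SetLike.coe_mem _
      · rw [← hxy]
        exact congrArg φ (Subtype.ext (e.apply_symm_apply _))
  exact ⟨P', Y, shiftGr Y j, g, cl_eq hy hP.toGSub (mI_le_self _) r,
    cl_eq hy g.toGSub (mI_le_self _) r', AddEquiv.refl _, fun _ _ => rfl, fun _ _ => rfl,
    fun _ _ h => h⟩

theorem exists_dmap [Module.Finite A H] [DirectSum.Decomposition 𝒜] {π : O →+* k}
    (hy : Hyp A π) : ∃ d : Groth A H 𝒜 K →+ Groth A H 𝒜 k,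
      ∀ (V : GrMod A H 𝒜 K) (P : Submodule O V.carrier), GLat V P → d V.cls = clm π V P := by
  let D : FreeAbelianGroup (GrMod A H 𝒜 K) →+ Groth A H 𝒜 k :=
    FreeAbelianGroup.lift (fun V => clm π V (Classical.choose (exists_lat hy.hAO V)))
  have hD : ∀ (V : GrMod A H 𝒜 K) (P : Submodule O V.carrier), GLat V P →
      D (FreeAbelianGroup.of V) = clm π V P := by
    intro V P hP
    rw [FreeAbelianGroup.lift_apply_of]
    exact two_lat hy (Classical.choose_spec (exists_lat hy.hAO V)) hP
  have hker : AddSubgroup.closure (grRelSet A H 𝒜 K) ≤ D.ker := by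
    rw [AddSubgroup.closure_le]
    rintro _ ⟨X, Y, Z, ⟨s⟩, rfl⟩
    obtain ⟨P, hP⟩ := exists_lat hy.hAO Y
    obtain ⟨P1, P3, h1, h3, h⟩ := clm_ses hy s hP
    change D _ = 0
    rw [map_sub, map_sub, hD Y P hP, hD X P1 h1, hD Z P3 h3, h]
    abel
  refine ⟨QuotientAddGroup.lift _ D hker, fun V P hP => ?_⟩
  exact hD V P hP

theorem clm_of_reduces {π : O →+* k} (hy : Hyp A π) {V : GrMod A H 𝒜 K}
    {LV : AddSubgroup V.carrier} (hL : V.IsLattice O LV) {Y : GrMod A H 𝒜 k}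
    {φ : LV →+ Y.carrier} (r : GrMod.Reduces O π V LV Y φ) :
    ∃ P : Submodule O V.carrier, GLat V P ∧ clm π V P = Y.cls := by
  obtain ⟨P, rfl, hP⟩ := lat_of_isLattice hL
  refine ⟨P, hP, cl_eq hy hP.toGSub (mI_le_self _) (φ := φ) ?_⟩
  rw [← mSub_eq]
  exact r

end Final


/-- Let `A` be integrally closed in `K = Frac(A)`, `θ : A → L` a
specialization (`L = Frac(θ(A))`), and `O ⊆ K` a valuation ring with `A ⊆ O` and
`J(O) ∩ A = Ker θ`, with residue field `k` (realized by the surjection `π : O → k` with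
kernel `J(O)` = the nonunits, and `L` embedded in `k` via `τ`).  Under the assumption that
`LH` is split, or `L = k` and `L` is perfect:  graded `O ⊗_A H`-lattices whose `K`-scalar
extensions have the same class in the graded Grothendieck group of `KH` have modular
reductions with the same class in the graded Grothendieck group of `kH`.  Hence modular
reduction induces a well-defined graded decomposition map
`d^gr_θ : R_0^+(KH) → R_0^+(LH) ≅ R_0^+(kH)`, `d^gr_θ([K ⊗_O Ṽ]) = [k ⊗_O Ṽ]`, and this map
commutes with the grading shifts, i.e. it is a homomorphism of `ℕ[q,q⁻¹]`-semigroups. -/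
theorem graded_decomposition_map_well_defined
    (A : Type u) [CommRing A] [IsDomain A] [IsIntegrallyClosed A]
    (K : Type u) [Field K] [Algebra A K] [IsFractionRing A K]
    (H : Type u) [Ring H] [Algebra A H] [Module.Free A H] [Module.Finite A H]
    (𝒜 : ℤ → Submodule A H) [GradedAlgebra 𝒜]
    (L : Type u) [Field L] [Algebra A L]
    (hLfrac : ∀ x : L, ∃ a b : A,
      algebraMap A L b ≠ 0 ∧ x * algebraMap A L b = algebraMap A L a)
    (O : ValuationSubring K) (hAO : ∀ a : A, algebraMap A K a ∈ O)
    (hJO : ∀ a : A, ¬ IsUnit (⟨algebraMap A K a, hAO a⟩ : O) ↔ algebraMap A L a = 0)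
    (k : Type u) [Field k] [Algebra A k]
    (π : O →+* k) (hπsurj : Function.Surjective π)
    (hπker : ∀ o : O, π o = 0 ↔ ¬ IsUnit o)
    (hπA : ∀ a : A, π ⟨algebraMap A K a, hAO a⟩ = algebraMap A k a)
    (τ : L →+* k) (hτ : ∀ a : A, τ (algebraMap A L a) = algebraMap A k a)
    (hass : SplitAlg A H L ∨ (Function.Surjective τ ∧ PerfectField L)) :
    (∀ (V W : GrMod A H 𝒜 K) (LV : AddSubgroup V.carrier) (LW : AddSubgroup W.carrier),
      V.IsLattice O LV → W.IsLattice O LW →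
      ∀ (Y Z : GrMod A H 𝒜 k) (φV : LV →+ Y.carrier) (φW : LW →+ Z.carrier),
        GrMod.Reduces O π V LV Y φV → GrMod.Reduces O π W LW Z φW →
        V.cls = W.cls → Y.cls = Z.cls) ∧
    (∃ d : Groth A H 𝒜 K →+ Groth A H 𝒜 k,
      (∀ (V : GrMod A H 𝒜 K) (LV : AddSubgroup V.carrier), V.IsLattice O LV →
        ∀ (Y : GrMod A H 𝒜 k) (φV : LV →+ Y.carrier),
          GrMod.Reduces O π V LV Y φV → d V.cls = Y.cls) ∧
      (∀ (j : ℤ) (V V' : GrMod A H 𝒜 K), V'.IsShiftOf V j →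
        ∃ Y Y' : GrMod A H 𝒜 k,
          d V.cls = Y.cls ∧ d V'.cls = Y'.cls ∧ Y'.IsShiftOf Y j)) := by
  have hy : Hyp A π := ⟨hAO, hπsurj, hπker, hπA⟩
  obtain ⟨d, hd⟩ := exists_dmap (𝒜 := 𝒜) hy
  have hd' : ∀ (V : GrMod A H 𝒜 K) (LV : AddSubgroup V.carrier), V.IsLattice O LV →
      ∀ (Y : GrMod A H 𝒜 k) (φV : LV →+ Y.carrier),
        GrMod.Reduces O π V LV Y φV → d V.cls = Y.cls := by
    intro V LV hL Y φ r
    obtain ⟨P, hP, hc⟩ := clm_of_reduces hy hL r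
    rw [hd V P hP, hc]
  refine ⟨?_, d, hd', ?_⟩
  · intro V W LV LW hV hW Y Z φV φW rV rW hVW
    rw [← hd' V LV hV Y φV rV, ← hd' W LW hW Z φW rW, hVW]
  · intro j V V' hs
    obtain ⟨P, hP⟩ := exists_lat hAO V
    obtain ⟨P', Y, Y', hP', h1, h2, h3⟩ := clm_shift hy hs hP
    exact ⟨Y, Y', by rw [hd V P hP, h1], by rw [hd V' P' hP', h2], h3⟩
end
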